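/- arXiv:0710.0642 — 2 statements merged into one kernel-verified Lean document; each statement's English description precedes it below -/
import Mathlib

section
/- There is an absolute constant C > 0 with the following property. Let A ⊆ ℝ be a finite nonempty set, α ∈ ℝ with α ≠ 0, and K ≥ 1 a real with |A + α·A| ≤ K·|A|. Then for every positive integer l, |(A−A) + α·(A−A) + α²·(A−A) + ⋯ + α^{l−1}·(A−A)| ≤ K^{C·l}·|A|. -/
open scoped Pointwise BigOperators

open Finset in
lemma ig_pr (A : Finset ℝ) (α K : ℝ) (hA : A.Nonempty) (hα : α ≠ 0)
    (h : ((Finset.image₂ (fun a b => a + α * b) A A).card : ℝ) ≤ K * A.card) (m n : ℕ) :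
    ((m • A - n • A).card : ℝ) ≤ K ^ (m + n) * A.card := by
  have hc : (A.image (fun x => α * x)).card = A.card :=
    card_image_of_injective _ (mul_right_injective₀ hα)
  have he : A.image (fun x => α * x) + A = Finset.image₂ (fun a b => a + α * b) A A := by
    ext x
    simp only [mem_add, mem_image, mem_image₂]
    constructor
    · rintro ⟨_, ⟨b, hb, rfl⟩, a, ha, rfl⟩
      exact ⟨a, ha, b, hb, add_comm _ _⟩
    · rintro ⟨a, ha, b, hb, rfl⟩
      exact ⟨_, ⟨b, hb, rfl⟩, a, ha, add_comm _ _⟩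
  have := pluennecke_ruzsa_inequality_nsmul_sub_nsmul_add (hA.image (fun x => α * x)) A m n
  rw [hc, he] at this
  have h2 : ((m • A - n • A).card : ℝ) ≤
      (((Finset.image₂ (fun a b => a + α * b) A A).card : ℝ) / A.card) ^ (m + n) * A.card := by
    have h3 := (NNRat.cast_le (K := ℝ)).2 this
    push_cast at h3
    exact h3
  have hpos : (0 : ℝ) < A.card := by exact_mod_cast hA.card_pos
  refine h2.trans ?_
  gcongr
  rwa [div_le_iff₀ hpos]

open Finset in
lemma ig_cover (A : Finset ℝ) (α K : ℝ) (hA : A.Nonempty) (hα : α ≠ 0)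
    (h : ((Finset.image₂ (fun a b => a + α * b) A A).card : ℝ) ≤ K * A.card) :
    ∃ X : Finset ℝ, (X.card : ℝ) ≤ K ^ 5 ∧
      ∀ d ∈ A - A, ∀ e ∈ A - A, ∃ x ∈ X, ∃ f ∈ A - A, d + e = x + f := by
  have h1 := ig_pr A α K hA hα h 3 2
  have hs : ((A - A) + (A - A)) + A ⊆ 3 • A - 2 • A := by
    intro x hx
    simp only [mem_add, mem_sub, succ_nsmul, zero_nsmul, zero_add] at hx ⊢
    obtain ⟨_, ⟨_, ⟨a, ha, b, hb, rfl⟩, _, ⟨c, hc, d, hd, rfl⟩, rfl⟩, e, he, rfl⟩ := hx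
    exact ⟨_, ⟨_, ⟨a, ha, c, hc, rfl⟩, e, he, rfl⟩, _, ⟨b, hb, d, hd, rfl⟩, by ring⟩
  have h2 : ((((A - A) + (A - A)) + A).card : ℝ) ≤ K ^ 5 * A.card :=
    le_trans (by exact_mod_cast card_le_card hs) h1
  obtain ⟨X, -, hX, hc⟩ := ruzsa_covering_add hA h2
  refine ⟨X, hX, fun d hd e he => ?_⟩
  obtain ⟨x, hx, f, hf, hxf⟩ := mem_add.1 (hc (add_mem_add hd he))
  exact ⟨x, hx, f, hf, hxf.symm⟩

open Finset in
lemma ig_cover2 (A : Finset ℝ) (α K : ℝ) (hA : A.Nonempty)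
    (h : ((Finset.image₂ (fun a b => a + α * b) A A).card : ℝ) ≤ K * A.card) :
    ∃ T : Finset ℝ, (T.card : ℝ) ≤ K ∧
      ∀ a ∈ A, ∃ t ∈ T, ∃ f ∈ A - A, α * a = t + f := by
  have hs : A.image (fun x => α * x) + A ⊆ Finset.image₂ (fun a b => a + α * b) A A := by
    intro x
    simp only [mem_add, mem_image, mem_image₂]
    rintro ⟨_, ⟨b, hb, rfl⟩, a, ha, rfl⟩
    exact ⟨a, ha, b, hb, add_comm _ _⟩
  have h2 : ((A.image (fun x => α * x) + A).card : ℝ) ≤ K * A.card :=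
    le_trans (by exact_mod_cast card_le_card hs) h
  obtain ⟨X, -, hX, hc⟩ := ruzsa_covering_add hA h2
  refine ⟨X, hX, fun d hd => ?_⟩
  obtain ⟨x, hx, f, hf, hxf⟩ := mem_add.1 (hc (mem_image_of_mem _ hd))
  exact ⟨x, hx, f, hf, hxf.symm⟩

open Finset in
lemma ig_ind (A : Finset ℝ) (α K : ℝ) (hA : A.Nonempty) (hα : α ≠ 0) (hK : 1 ≤ K)
    (h : ((Finset.image₂ (fun a b => a + α * b) A A).card : ℝ) ≤ K * A.card) (l : ℕ) :
    ∃ Y : Finset ℝ, (Y.card : ℝ) ≤ K ^ (12 * l) ∧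
      ∀ y : Fin (l + 1) → ℝ, (∀ i, y i ∈ A - A) →
        ∃ u ∈ Y, ∃ d ∈ A - A, ∑ i : Fin (l + 1), α ^ (i : ℕ) * y i = u + d := by
  obtain ⟨X, hX, hXc⟩ := ig_cover A α K hA hα h
  obtain ⟨T, hT, hTc⟩ := ig_cover2 A α K hA h
  induction l with
  | zero =>
    refine ⟨{0}, by simp, fun y hy => ⟨0, by simp, y 0, hy 0, by simp⟩⟩
  | succ l ih =>
    obtain ⟨Y, hY, hYc⟩ := ih
    refine ⟨Y.image (fun x => α * x) + ((T - T) + X + X), ?_, fun y hy => ?_⟩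
    · have e1 : (Y.image (fun x => α * x) + ((T - T) + X + X)).card ≤
          Y.card * (T.card * T.card * X.card * X.card) := by
        refine card_add_le.trans (Nat.mul_le_mul card_image_le ?_)
        refine card_add_le.trans (Nat.mul_le_mul_right _ ?_)
        refine card_add_le.trans (Nat.mul_le_mul_right _ ?_)
        exact card_sub_le
      calc ((Y.image (fun x => α * x) + ((T - T) + X + X)).card : ℝ)
          ≤ Y.card * (T.card * T.card * X.card * X.card) := by exact_mod_cast e1
        _ ≤ K ^ (12 * l) * (K * K * K ^ 5 * K ^ 5) := by gcongr
        _ = K ^ (12 * (l + 1)) := by ring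
    · obtain ⟨u, hu, d, hd, hud⟩ := hYc (fun i => y i.succ) (fun i => hy _)
      obtain ⟨a, ha, b, hb, rfl⟩ := mem_sub.1 hd
      obtain ⟨t, ht, f, hf, htf⟩ := hTc a ha
      obtain ⟨s, hs, g, hg, hsg⟩ := hTc b hb
      have hg' : -g ∈ A - A := by
        obtain ⟨p, hp, q, hq, rfl⟩ := mem_sub.1 hg
        rw [neg_sub]; exact sub_mem_sub hq hp
      obtain ⟨x, hx, k, hk, hxk⟩ := hXc f hf (-g) hg'
      obtain ⟨z, hz, w, hw, hzw⟩ := hXc (y 0) (hy 0) k hk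
      refine ⟨α * u + ((t - s) + x + z), ?_, w, hw, ?_⟩
      · exact add_mem_add (mem_image_of_mem _ hu)
          (add_mem_add (add_mem_add (sub_mem_sub ht hs) hx) hz)
      · rw [Fin.sum_univ_succ]
        have : ∑ i : Fin (l + 1), α ^ ((i.succ : Fin (l + 2)) : ℕ) * y i.succ
            = α * (u + (a - b)) := by
          rw [← hud, mul_sum]
          refine sum_congr rfl fun i _ => ?_
          rw [Fin.val_succ]; ring
        rw [this]
        simp only [Fin.val_zero, pow_zero, one_mul]
        linear_combination htf - hsg + hxk + hzw

/-- **Iterated growth (Lemma 6.1).** There is an absolute constant `C > 0` such that: if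
`A ⊆ ℝ` is finite and nonempty, `α ≠ 0` and `|A + α·A| ≤ K|A|` (`K ≥ 1`), then for every
positive integer `l`,
`|(A-A) + α·(A-A) + α²·(A-A) + ⋯ + α^{l-1}·(A-A)| ≤ K^{Cl}|A|`. -/
theorem iterated_growth :
    ∃ C : ℝ, 0 < C ∧
      ∀ (A : Finset ℝ) (α K : ℝ), A.Nonempty → α ≠ 0 → 1 ≤ K →
        ((Finset.image₂ (fun a b => a + α * b) A A).card : ℝ) ≤ K * A.card →
        ∀ l : ℕ, 0 < l →
          (((Fintype.piFinset fun _ : Fin l => A - A).image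
              fun y : Fin l → ℝ => ∑ i : Fin l, α ^ (i : ℕ) * y i).card : ℝ) ≤
            K ^ (C * l) * A.card := by
  refine ⟨12, by norm_num, fun A α K hA hα hK h l hl => ?_⟩
  obtain ⟨l, rfl⟩ : ∃ k, l = k + 1 := ⟨l - 1, by omega⟩
  obtain ⟨Y, hY, hYc⟩ := ig_ind A α K hA hα hK h l
  have h2 := ig_pr A α K hA hα h 1 1
  rw [one_nsmul] at h2
  have hs : ((Fintype.piFinset fun _ : Fin (l + 1) => A - A).image
      fun y : Fin (l + 1) → ℝ => ∑ i : Fin (l + 1), α ^ (i : ℕ) * y i) ⊆ Y + (A - A) := by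
    intro x hx
    obtain ⟨y, hy, rfl⟩ := Finset.mem_image.1 hx
    obtain ⟨u, hu, d, hd, hud⟩ := hYc y (Fintype.mem_piFinset.1 hy)
    exact Finset.mem_add.2 ⟨u, hu, d, hd, hud.symm⟩
  have h3 := (Finset.card_le_card hs).trans Finset.card_add_le
  have e : K ^ ((12 : ℝ) * ((l + 1 : ℕ) : ℝ)) = K ^ (12 * (l + 1)) := by
    rw [← Real.rpow_natCast]; push_cast; rfl
  rw [e]
  calc _ ≤ (Y.card : ℝ) * (A - A).card := by exact_mod_cast h3
    _ ≤ K ^ (12 * l) * (K ^ (1 + 1) * A.card) := by gcongr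
    _ = K ^ (12 * l + 2) * A.card := by ring
    _ ≤ K ^ (12 * (l + 1)) * A.card := by
      gcongr
      omega
end

section
/- There is an absolute constant C > 0 with the following property. Let A, B ⊆ ℤ be finite nonempty sets with |A + B| ≤ K·min{|A|,|B|} for a real K ≥ 2, and let k ≥ 2 be a positive integer. Then there exist a positive integer N with N ≤ K^{C·k}·min{|A|,|B|}, subsets A₁ ⊆ A and B₁ ⊆ B with |A₁| ≥ |A|/k and |B₁| ≥ |B|/k, and a map ψ defined on A₁ ∪ B₁ with values in ℤ/Nℤ which is a Freiman k-isomorphism onto its image, such that the sets A'' := ψ(A₁) and B'' := ψ(B₁) satisfy |A'' + B''| ≤ k·K·min{|A''|,|B''|}. -/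
open scoped Pointwise


open Finset in
lemma fr_exists_large {p : ℕ} [Fact p.Prime] (Y : Finset (ZMod p)) (hY : Y.Nonempty)
    (hp : 2 * #(Y + Y) ≤ p) :
    ∃ q : ZMod p, q ≠ 0 ∧
      (#Y : ℝ) ^ 3 ≤ 2 * #(Y + Y) * ‖∑ y ∈ Y, ZMod.stdAddChar (q * y)‖ ^ 2 := by
  set F : ZMod p → ℂ := fun q => ∑ y ∈ Y, ZMod.stdAddChar (q * y) with hF
  have hYpos : (0:ℝ) < #Y := by exact_mod_cast hY.card_pos
  have hYY : (0:ℝ) < #(Y + Y) := by exact_mod_cast (hY.add hY).card_pos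
  have hppos : (0:ℝ) < p := by exact_mod_cast (Fact.out : p.Prime).pos
  have hprim := ZMod.isPrimitive_stdAddChar p
  have hsq : ∀ q, ((‖F q‖ ^ 2 : ℝ) : ℂ) = ∑ a ∈ Y, ∑ b ∈ Y, ZMod.stdAddChar (q * (a - b)) := by
    intro q
    have : ((‖F q‖ ^ 2 : ℝ) : ℂ) = F q * (starRingEnd ℂ) (F q) := by
      rw [Complex.mul_conj, Complex.normSq_eq_norm_sq]
    rw [this, hF]
    simp only [map_sum]
    rw [Finset.sum_mul_sum]
    refine Finset.sum_congr rfl fun a _ => Finset.sum_congr rfl fun b _ => ?_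
    rw [← AddChar.map_neg_eq_conj, ← AddChar.map_add_eq_mul]
    congr 1; ring
  have hpars : ∑ q, ‖F q‖ ^ 2 = p * #Y := by
    have : ((∑ q, ‖F q‖ ^ 2 : ℝ) : ℂ) = p * #Y := by
      push_cast
      have : ∀ q, ((‖F q‖ : ℂ)) ^ 2 = ∑ a ∈ Y, ∑ b ∈ Y, ZMod.stdAddChar (q * (a - b)) := by
        intro q; rw [← hsq]; push_cast; rfl
      simp_rw [this]
      rw [Finset.sum_comm]
      simp_rw [Finset.sum_comm (s := Finset.univ), AddChar.sum_mulShift _ hprim, sub_eq_zero]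
      simp [mul_comm]
    exact_mod_cast this
  have henergy : ∑ q, ‖F q‖ ^ 4 = p * Y.addEnergy Y := by
    have : ((∑ q, ‖F q‖ ^ 4 : ℝ) : ℂ) = p * Y.addEnergy Y := by
      push_cast
      have : ∀ q, ((‖F q‖ : ℂ)) ^ 4 = ∑ x ∈ (Y ×ˢ Y) ×ˢ (Y ×ˢ Y),
          ZMod.stdAddChar (q * ((x.1.1 - x.1.2) + (x.2.1 - x.2.2))) := by
        intro q
        have h2 := hsq q
        push_cast at h2
        rw [show ((‖F q‖ : ℂ)) ^ 4 = (‖F q‖ : ℂ) ^ 2 * (‖F q‖ : ℂ) ^ 2 by ring, h2,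
          ← Finset.sum_product', Finset.sum_mul_sum, ← Finset.sum_product']
        refine Finset.sum_congr rfl fun x _ => ?_
        rw [← AddChar.map_add_eq_mul]
        congr 1; ring
      simp_rw [this]
      rw [Finset.sum_comm]
      simp_rw [AddChar.sum_mulShift _ hprim]
      rw [Finset.addEnergy, Finset.card_filter, Nat.cast_sum, Finset.mul_sum]
      refine Finset.sum_congr rfl fun x _ => ?_
      have : (x.1.1 - x.1.2) + (x.2.1 - x.2.2) = 0 ↔ x.1.1 + x.2.1 = x.1.2 + x.2.2 := by
        rw [← sub_eq_zero (a := x.1.1 + x.2.1)]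
        constructor <;> intro h <;> rw [← h] <;> ring
      simp only [this, ZMod.card]
      split_ifs <;> simp
    exact_mod_cast this
  have hCS : (#Y : ℝ) ^ 4 ≤ #(Y + Y) * Y.addEnergy Y := by
    have := Finset.le_card_add_mul_addEnergy Y Y
    have h2 : #Y ^ 4 ≤ #(Y + Y) * Y.addEnergy Y := by
      calc #Y ^ 4 = #Y ^ 2 * #Y ^ 2 := by ring
        _ ≤ _ := this
    exact_mod_cast h2
  have hp' : (2:ℝ) * #(Y + Y) ≤ p := by exact_mod_cast hp
  by_contra! hcon
  have hF0 : ‖F 0‖ = #Y := by simp [hF]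
  have hs2 : ∑ q ∈ Finset.univ.erase (0 : ZMod p), ‖F q‖ ^ 2 = p * #Y - (#Y:ℝ) ^ 2 := by
    rw [← hpars, ← Finset.add_sum_erase _ _ (Finset.mem_univ (0 : ZMod p)), hF0]; ring
  have hs4 : ∑ q ∈ Finset.univ.erase (0 : ZMod p), ‖F q‖ ^ 4 = p * Y.addEnergy Y - (#Y:ℝ) ^ 4 := by
    rw [← henergy, ← Finset.add_sum_erase _ _ (Finset.mem_univ (0 : ZMod p)), hF0]; ring
  have hle : 2 * (#(Y + Y):ℝ) * ∑ q ∈ Finset.univ.erase (0 : ZMod p), ‖F q‖ ^ 4 ≤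
      (#Y:ℝ) ^ 3 * ∑ q ∈ Finset.univ.erase (0 : ZMod p), ‖F q‖ ^ 2 := by
    rw [Finset.mul_sum, Finset.mul_sum]
    refine Finset.sum_le_sum fun q hq => ?_
    have := (hcon q (Finset.ne_of_mem_erase hq)).le
    calc 2 * (#(Y + Y):ℝ) * ‖F q‖ ^ 4 = (2 * (#(Y + Y):ℝ) * ‖F q‖ ^ 2) * ‖F q‖ ^ 2 := by ring
      _ ≤ _ := by gcongr
  rw [hs2, hs4] at hle
  have h1 : (p:ℝ) * #Y ^ 4 ≤ p * (#(Y + Y) * Y.addEnergy Y) := by gcongr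
  have h2 : (2 * #(Y + Y)) * (#Y:ℝ) ^ 4 ≤ p * #Y ^ 4 := by gcongr
  have h3 : 0 < (#Y:ℝ) ^ 5 := by positivity
  nlinarith

lemma fr_char_lower {p : ℕ} [NeZero p] (t : ZMod p) :
    4 * (|t.valMinAbs| : ℝ) ≤ p * ‖(ZMod.stdAddChar t : ℂ) - 1‖ := by
  have hp : (0:ℝ) < p := by exact_mod_cast Nat.pos_of_ne_zero (NeZero.ne p)
  have h1 : (ZMod.stdAddChar t : ℂ) = Complex.exp (Complex.I * ((2 * Real.pi * t.valMinAbs / p : ℝ) : ℂ)) := by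
    conv_lhs => rw [← ZMod.coe_valMinAbs t]
    rw [ZMod.stdAddChar_coe]
    congr 1; push_cast; ring
  rw [h1, Complex.norm_exp_I_mul_ofReal_sub_one]
  have hb : (|t.valMinAbs| : ℝ) ≤ p / 2 := by
    have h := ZMod.natAbs_valMinAbs_le t
    have : ((t.valMinAbs.natAbs : ℕ) : ℝ) ≤ ((p / 2 : ℕ) : ℝ) := by exact_mod_cast h
    rw [Nat.cast_natAbs] at this
    have h3 : ((p / 2 : ℕ) : ℝ) ≤ p / 2 := Nat.cast_div_le
    push_cast at this
    linarith
  have hx : |2 * Real.pi * t.valMinAbs / p / 2| = Real.pi * |(t.valMinAbs:ℝ)| / p := by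
    rw [show 2 * Real.pi * (t.valMinAbs:ℝ) / p / 2 = Real.pi * t.valMinAbs / p by ring, abs_div,
      abs_mul, abs_of_pos Real.pi_pos, abs_of_pos hp]
  have := Real.mul_abs_le_abs_sin (x := 2 * Real.pi * t.valMinAbs / p / 2) (by
    rw [hx, div_le_iff₀ hp]; nlinarith [Real.pi_pos])
  rw [hx] at this
  rw [norm_mul, Real.norm_eq_abs, Real.norm_eq_abs, abs_two]
  have h2 : 2 / Real.pi * (Real.pi * |(t.valMinAbs:ℝ)| / p) = 2 * |(t.valMinAbs:ℝ)| / p := by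
    field_simp
  rw [h2, div_le_iff₀ hp] at this
  linarith

open Finset in
lemma fr_concentrate {p : ℕ} [Fact p.Prime] (Y H : Finset (ZMod p)) (hY : Y.Nonempty)
    (h0 : 0 ∈ H) (hp : 2 * #(Y + Y) ≤ p) (m η : ℝ) (hm : 0 < m) (_hη : 0 ≤ η)
    (hdoub : (#(Y + Y) : ℝ) ≤ m ^ 2 * #Y) (hgrow : (#(Y + H) : ℝ) ≤ (1 + η) * #Y) :
    ∃ q : ZMod p, q ≠ 0 ∧ ∀ h ∈ H, (|(q * h).valMinAbs| : ℝ) ≤ p * (η * m) := by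
  obtain ⟨q, hq, hlarge⟩ := fr_exists_large Y hY hp
  refine ⟨q, hq, fun h hh => ?_⟩
  have hYpos : (0:ℝ) < #Y := by exact_mod_cast hY.card_pos
  have hppos : (0:ℝ) < p := by exact_mod_cast (Fact.out : p.Prime).pos
  set S : ℂ := ∑ y ∈ Y, ZMod.stdAddChar (q * y) with hS
  have hSm : (#Y : ℝ) ≤ 2 * m * ‖S‖ := by
    have h1 : (#Y : ℝ) ^ 3 ≤ 2 * (m ^ 2 * #Y) * ‖S‖ ^ 2 := hlarge.trans (by gcongr)
    have h2 : (#Y : ℝ) ^ 2 ≤ (2 * m * ‖S‖) ^ 2 := by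
      have : (#Y : ℝ) * #Y ^ 2 ≤ #Y * (2 * m * ‖S‖) ^ 2 := by nlinarith [sq_nonneg (m * ‖S‖)]
      exact le_of_mul_le_mul_left this hYpos
    exact (pow_le_pow_iff_left₀ hYpos.le (by positivity) two_ne_zero).1 h2
  -- shift
  have hshift : ‖(ZMod.stdAddChar (q * h) : ℂ) - 1‖ * ‖S‖ ≤ 2 * (η * #Y) := by
    rw [← norm_mul]
    set Y' := Y.image (fun y => y + h) with hY'
    have e1 : (ZMod.stdAddChar (q * h) : ℂ) * S = ∑ y ∈ Y', ZMod.stdAddChar (q * y) := by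
      rw [hY', Finset.sum_image (by intro a _ b _ hab; simpa using hab), hS, Finset.mul_sum]
      refine Finset.sum_congr rfl fun a _ => ?_
      rw [← AddChar.map_add_eq_mul]; congr 1; ring
    have e2 : ((ZMod.stdAddChar (q * h) : ℂ) - 1) * S =
        ∑ y ∈ Y' \ Y, ZMod.stdAddChar (q * y) - ∑ y ∈ Y \ Y', ZMod.stdAddChar (q * y) := by
      rw [sub_mul, e1, one_mul, hS, Finset.sum_sdiff_sub_sum_sdiff]
    have hnorm : ∀ T : Finset (ZMod p), ‖∑ y ∈ T, (ZMod.stdAddChar (q * y) : ℂ)‖ ≤ #T := by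
      intro T
      refine (norm_sum_le _ _).trans ?_
      simp
    have hc : #Y' = #Y := Finset.card_image_of_injective _ (add_left_injective h)
    have hu : (#(Y ∪ Y') : ℝ) ≤ (1 + η) * #Y := by
      refine le_trans ?_ hgrow
      have : Y ∪ Y' ⊆ Y + H := by
        intro x hx
        rcases Finset.mem_union.1 hx with hx | hx
        · exact Finset.mem_add.2 ⟨x, hx, 0, h0, add_zero x⟩
        · obtain ⟨y, hy, rfl⟩ := Finset.mem_image.1 hx
          exact Finset.add_mem_add hy hh
      exact_mod_cast Finset.card_le_card this
    have c1 : (#(Y' \ Y) : ℝ) ≤ η * #Y := by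
      have : #(Y' \ Y) + #Y = #(Y ∪ Y') := by rw [Finset.card_sdiff_add_card, Finset.union_comm]
      have : (#(Y' \ Y) : ℝ) + #Y = #(Y ∪ Y') := by exact_mod_cast this
      linarith
    have c2 : (#(Y \ Y') : ℝ) ≤ η * #Y := by
      have : #(Y \ Y') + #Y = #(Y ∪ Y') := by rw [← hc, Finset.card_sdiff_add_card]
      have : (#(Y \ Y') : ℝ) + #Y = #(Y ∪ Y') := by exact_mod_cast this
      linarith
    rw [e2]
    refine (norm_sub_le _ _).trans ?_
    linarith [hnorm (Y' \ Y), hnorm (Y \ Y')]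
  have h4 := fr_char_lower (q * h)
  set v := ‖(ZMod.stdAddChar (q * h) : ℂ) - 1‖
  have hv : 0 ≤ v := norm_nonneg _
  have : v * #Y ≤ 4 * (η * m) * #Y := by
    calc v * #Y ≤ v * (2 * m * ‖S‖) := by gcongr
      _ = 2 * m * (v * ‖S‖) := by ring
      _ ≤ 2 * m * (2 * (η * #Y)) := by gcongr
      _ = _ := by ring
  have hv2 : v ≤ 4 * (η * m) := le_of_mul_le_mul_right this hYpos
  have : p * v ≤ p * (4 * (η * m)) := by gcongr
  linarith

open Finset in
lemma fr_nsmul_card {G : Type*} [AddCommGroup G] [DecidableEq G] (F : Finset G) (r : ℕ) :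
    #(r • F) ≤ (r + 1) ^ #F := by
  have key : ∀ r : ℕ, ∀ x ∈ r • F, ∃ c : G → ℕ, (∀ f, c f ≤ r) ∧ x = ∑ f ∈ F, c f • f := by
    intro r
    induction r with
    | zero => intro x hx; refine ⟨fun _ => 0, by simp, ?_⟩; simpa using hx
    | succ r ih =>
      intro x hx
      rw [succ_nsmul] at hx
      obtain ⟨y, hy, f, hf, rfl⟩ := Finset.mem_add.1 hx
      obtain ⟨c, hc, rfl⟩ := ih y hy
      refine ⟨fun g => c g + if g = f then 1 else 0, fun g => ?_, ?_⟩
      · have := hc g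
        dsimp only
        split_ifs <;> omega
      · simp only [add_smul, Finset.sum_add_distrib, ite_smul, one_smul, zero_smul]
        simp [hf]
  have hsub : r • F ⊆ (F.pi (fun _ => Finset.range (r + 1))).image
      (fun c => ∑ f ∈ F.attach, c f.1 f.2 • f.1) := by
    intro x hx
    obtain ⟨c, hc, rfl⟩ := key r x hx
    refine Finset.mem_image.2 ⟨fun f _ => c f, ?_, ?_⟩
    · simp only [Finset.mem_pi, Finset.mem_range]
      intro f _; exact Nat.lt_succ_of_le (hc f)
    · exact Finset.sum_attach F (fun f => c f • f)
  refine (Finset.card_le_card hsub).trans (Finset.card_image_le.trans ?_)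
  simp [Finset.card_pi]

open Finset in
lemma fr_growth {G : Type*} [AddCommGroup G] [DecidableEq G] (F H : Finset G) (s : ℕ)
    (hF : #F ≤ s) (hFH : H + H ⊆ F + H) (r : ℕ) : #((r + 1) • H) ≤ (r + 1) ^ s * #H := by
  have h1 : ∀ r : ℕ, (r + 1) • H ⊆ r • F + H := by
    intro r
    induction r with
    | zero => simp
    | succ r ih =>
      calc (r + 1 + 1) • H = (r + 1) • H + H := by rw [succ_nsmul]
        _ ⊆ (r • F + H) + H := by gcongr
        _ = r • F + (H + H) := add_assoc _ _ _
        _ ⊆ r • F + (F + H) := by gcongr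
        _ = (r + 1) • F + H := by rw [← add_assoc, ← succ_nsmul]
  calc #((r + 1) • H) ≤ #(r • F + H) := Finset.card_le_card (h1 r)
    _ ≤ #(r • F) * #H := Finset.card_add_le
    _ ≤ (r + 1) ^ #F * #H := by gcongr; exact fr_nsmul_card F r
    _ ≤ _ := by gcongr; omega

open Finset in
lemma fr_dilate {p : ℕ} [Fact p.Prime] (F H : Finset (ZMod p)) (s κ i₀ : ℕ) (hs : 1 ≤ s)
    (hκ : 1 ≤ κ) (h0 : 0 ∈ H) (hF : #F ≤ s) (hFH : H + H ⊆ F + H)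
    (hi : 8 * κ * 2 ^ (2 * s) * (4 * s) ≤ 2 ^ i₀)
    (hp : 2 * (2 ^ ((3 * i₀ + 2) * s) * #H) ≤ p) :
    ∃ q : ZMod p, q ≠ 0 ∧ ∀ h ∈ H, (|(q * h).valMinAbs| : ℝ) ≤ p / (8 * κ) := by
  have hgr : ∀ i : ℕ, #(2 ^ i • H) ≤ 2 ^ (i * s) * #H := by
    intro i
    have := fr_growth F H s hF hFH (2 ^ i - 1)
    rwa [Nat.sub_add_cancel Nat.one_le_two_pow, ← pow_mul] at this
  have hmono : ∀ a b : ℕ, a ≤ b → a • H ⊆ b • H := fun a b hab =>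
    Finset.nsmul_subset_nsmul_right h0 hab
  have hHpos : 0 < #H := Finset.card_pos.2 ⟨0, h0⟩
  have hi1 : 1 ≤ i₀ := by
    rcases Nat.eq_zero_or_pos i₀ with h | h
    · subst h
      have : 1 ≤ κ * 2 ^ (2 * s) * s := Nat.mul_pos (Nat.mul_pos hκ (by positivity)) hs
      nlinarith
    · exact h
  -- choose a scale
  obtain ⟨t, ht, hti⟩ : ∃ t < i₀, #(2 ^ (i₀ + 2 * t + 2) • H) ≤ 2 ^ (4 * s) * #(2 ^ (i₀ + 2 * t) • H) := by
    by_contra! hcon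
    have : ∀ T ≤ i₀, 2 ^ (4 * s * T) * #(2 ^ i₀ • H) ≤ #(2 ^ (i₀ + 2 * T) • H) ∧
        (1 ≤ T → 2 ^ (4 * s * T) * #(2 ^ i₀ • H) < #(2 ^ (i₀ + 2 * T) • H)) := by
      intro T
      induction T with
      | zero => intro _; simp
      | succ T ih =>
        intro hT
        have h1 := (ih (by omega)).1
        have h2 := hcon T (by omega)
        have h3 : 2 ^ (4 * s * (T + 1)) * #(2 ^ i₀ • H) < #(2 ^ (i₀ + 2 * (T + 1)) • H) := by
          calc 2 ^ (4 * s * (T + 1)) * #(2 ^ i₀ • H)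
              = 2 ^ (4 * s) * (2 ^ (4 * s * T) * #(2 ^ i₀ • H)) := by ring
            _ ≤ 2 ^ (4 * s) * #(2 ^ (i₀ + 2 * T) • H) := by gcongr
            _ < _ := h2
        exact ⟨h3.le, fun _ => h3⟩
    have h1 := (this i₀ le_rfl).2 hi1
    have h2 := hgr (i₀ + 2 * i₀)
    have h3 : #H ≤ #(2 ^ i₀ • H) := by
      have := hmono 1 (2 ^ i₀) Nat.one_le_two_pow
      rw [one_smul] at this
      exact Finset.card_le_card this
    have h4 : 2 ^ ((i₀ + 2 * i₀) * s) * #H ≤ 2 ^ (4 * s * i₀) * #(2 ^ i₀ • H) := by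
      exact Nat.mul_le_mul (Nat.pow_le_pow_right (by norm_num) (by nlinarith)) h3
    omega
  set i := i₀ + 2 * t with hidef
  set R := 2 ^ i with hR
  set u : ℕ := 8 * κ * 2 ^ (2 * s) with hu
  have hupos : 0 < u := by positivity
  have hRu : u * (4 * s) ≤ R := hi.trans (Nat.pow_le_pow_right (by norm_num) (by omega))
  have hRpos : 0 < R := by positivity
  have hcpos : ∀ j, 0 < j → (0:ℝ) < #(j • H) := by
    intro j hj
    have : 0 < #(j • H) := Finset.card_pos.2 ⟨0, by
      have := hmono 0 j (Nat.zero_le _)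
      rw [zero_smul] at this
      exact this (Finset.mem_zero.2 rfl)⟩
    exact_mod_cast this
  obtain ⟨j, hj1, hj2, hj3⟩ : ∃ j, R ≤ j ∧ j < 2 * R ∧ (#((j + 1) • H) : ℝ) ≤ (1 + 1 / (u:ℝ)) * #(j • H) := by
    by_contra! hcon
    have hstep : ∀ T ≤ R, (1 + 1 / (u:ℝ)) ^ T * #(R • H) ≤ #((R + T) • H) := by
      intro T
      induction T with
      | zero => intro _; simp
      | succ T ih =>
        intro hT
        have h2 := hcon (R + T) (by omega) (by omega)
        calc (1 + 1 / (u:ℝ)) ^ (T + 1) * #(R • H) = (1 + 1 / (u:ℝ)) * ((1 + 1 / (u:ℝ)) ^ T * #(R • H)) := by ring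
          _ ≤ (1 + 1 / (u:ℝ)) * #((R + T) • H) := by gcongr; exact ih (by omega)
          _ ≤ _ := by rw [← add_assoc]; exact h2.le
    have h1 := hstep (R - 1) (by omega)
    have h2 := hcon (R + (R - 1)) (by omega) (by omega)
    have h3 : (1 + 1 / (u:ℝ)) ^ R * #(R • H) < #((2 * R) • H) := by
      calc (1 + 1 / (u:ℝ)) ^ R * #(R • H) = (1 + 1 / (u:ℝ)) * ((1 + 1 / (u:ℝ)) ^ (R - 1) * #(R • H)) := by
            rw [← mul_assoc, ← pow_succ', Nat.sub_add_cancel hRpos]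
        _ ≤ (1 + 1 / (u:ℝ)) * #((R + (R - 1)) • H) := by gcongr
        _ < #((R + (R - 1) + 1) • H) := h2
        _ = _ := by congr 3; omega
    have h4 : (2:ℝ) ^ (4 * s) ≤ (1 + 1 / (u:ℝ)) ^ R := by
      have hb : (2:ℝ) ≤ (1 + 1 / (u:ℝ)) ^ u := by
        have := one_add_mul_le_pow (a := 1 / (u:ℝ)) (by
          have : (0:ℝ) ≤ 1 / u := by positivity
          linarith) u
        have e : (u:ℝ) * (1 / u) = 1 := by field_simp
        rw [e] at this
        linarith
      calc (2:ℝ) ^ (4 * s) ≤ ((1 + 1 / (u:ℝ)) ^ u) ^ (4 * s) := by gcongr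
        _ = (1 + 1 / (u:ℝ)) ^ (u * (4 * s)) := (pow_mul _ _ _).symm
        _ ≤ _ := by
          apply pow_le_pow_right₀ _ hRu
          have : (0:ℝ) ≤ 1 / u := by positivity
          linarith
    have h5 : #((2 * R) • H) ≤ 2 ^ (4 * s) * #(R • H) := by
      refine le_trans (Finset.card_le_card (hmono _ _ ?_)) hti
      rw [pow_add, ← hR]; omega
    have h6 : (#((2 * R) • H) : ℝ) ≤ 2 ^ (4 * s) * #(R • H) := by exact_mod_cast h5
    have h7 : (2:ℝ) ^ (4 * s) * #(R • H) ≤ (1 + 1 / (u:ℝ)) ^ R * #(R • H) := by gcongr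
    linarith
  have hYY : (j • H) + (j • H) ⊆ 2 ^ (i + 2) • H := by
    rw [← add_nsmul]
    apply hmono
    rw [pow_add, ← hR]; omega
  have hYYc := Finset.card_le_card hYY
  have hjpos : 0 < j := by omega
  have hYne : (j • H).Nonempty := Finset.card_pos.1 (by exact_mod_cast hcpos j hjpos)
  obtain ⟨q, hq, hall⟩ := fr_concentrate (j • H) H hYne h0 (by
      refine le_trans ?_ hp
      gcongr
      refine hYYc.trans ((hgr (i + 2)).trans ?_)
      refine Nat.mul_le_mul (Nat.pow_le_pow_right (by norm_num) (Nat.mul_le_mul ?_ le_rfl)) le_rfl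
      omega) (2 ^ (2 * s)) (1 / (u:ℝ)) (by positivity) (by positivity) (by
      have h5 : #(j • H + j • H) ≤ 2 ^ (4 * s) * #(j • H) := by
        refine hYYc.trans (hti.trans ?_)
        gcongr
      have h6 : (#(j • H + j • H) : ℝ) ≤ 2 ^ (4 * s) * #(j • H) := by exact_mod_cast h5
      refine h6.trans (le_of_eq ?_)
      ring) (by rw [← succ_nsmul]; exact hj3)
  refine ⟨q, hq, fun h hh => (hall h hh).trans (le_of_eq ?_)⟩
  rw [hu]; push_cast
  have : (2:ℝ) ^ (2 * s) ≠ 0 := by positivity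
  have : (κ:ℝ) ≠ 0 := by positivity
  field_simp

def FrIso {G : Type*} [AddCommGroup G] (k : ℕ) (X : Finset ℤ) (φ : ℤ → G) : Prop :=
  ∀ s t : Multiset ℤ, (∀ x ∈ s, x ∈ X) → (∀ x ∈ t, x ∈ X) → s.card = k → t.card = k →
    ((s.map φ).sum = (t.map φ).sum ↔ s.sum = t.sum)

lemma FrIso.mono {G : Type*} [AddCommGroup G] {k m : ℕ} {X : Finset ℤ} {φ : ℤ → G}
    (h : FrIso k X φ) (hX : X.Nonempty) (hm : m ≤ k) : FrIso m X φ := by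
  obtain ⟨x, hx⟩ := hX
  intro s t hs ht hsc htc
  have := h (s + Multiset.replicate (k - m) x) (t + Multiset.replicate (k - m) x)
    (by intro y hy; rcases Multiset.mem_add.1 hy with hy | hy
        · exact hs y hy
        · rw [Multiset.eq_of_mem_replicate hy]; exact hx)
    (by intro y hy; rcases Multiset.mem_add.1 hy with hy | hy
        · exact ht y hy
        · rw [Multiset.eq_of_mem_replicate hy]; exact hx)
    (by simp; omega) (by simp; omega)
  simpa using this

lemma fr_mem_nsmul_image {G : Type*} [AddCommGroup G] [DecidableEq G] (X : Finset ℤ) (φ : ℤ → G)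
    (m : ℕ) (y : G) (hy : y ∈ m • (X.image φ)) :
    ∃ s : Multiset ℤ, (∀ x ∈ s, x ∈ X) ∧ s.card = m ∧ (s.map φ).sum = y := by
  induction m generalizing y with
  | zero => exact ⟨0, by simp, by simp, by
      rw [zero_nsmul, Finset.mem_zero] at hy; simp [hy]⟩
  | succ m ih =>
    rw [succ_nsmul] at hy
    obtain ⟨z, hz, w, hw, rfl⟩ := Finset.mem_add.1 hy
    obtain ⟨s, hs, hc, rfl⟩ := ih z hz
    obtain ⟨x, hx, rfl⟩ := Finset.mem_image.1 hw
    refine ⟨x ::ₘ s, ?_, by simp [hc], by simp [add_comm]⟩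
    intro a ha
    rcases Multiset.mem_cons.1 ha with rfl | ha
    · exact hx
    · exact hs a ha

lemma fr_sum_mem_nsmul {G : Type*} [AddCommGroup G] [DecidableEq G] (X : Finset ℤ) (φ : ℤ → G)
    (s : Multiset ℤ) (hs : ∀ x ∈ s, x ∈ X) :
    (s.map φ).sum ∈ s.card • (X.image φ) := by
  induction s using Multiset.induction_on with
  | empty => simp
  | cons a s ih =>
    rw [Multiset.map_cons, Multiset.sum_cons, Multiset.card_cons, succ_nsmul, add_comm (φ a)]
    exact Finset.add_mem_add (ih fun x hx => hs x (Multiset.mem_cons_of_mem hx))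
      (Finset.mem_image_of_mem _ (hs a (Multiset.mem_cons_self _ _)))

open Finset in
lemma FrIso.card_le {G : Type*} [AddCommGroup G] [DecidableEq G] {k m l : ℕ} {X : Finset ℤ}
    {φ : ℤ → G} (h : FrIso k X φ) (hX : X.Nonempty) (hm : m + l ≤ k) :
    #(m • (X.image φ) - l • (X.image φ)) ≤ #(m • X - l • X) := by
  have h' := h.mono hX hm
  have key : ∀ y ∈ m • (X.image φ) - l • (X.image φ), ∃ st : Multiset ℤ × Multiset ℤ,
      ((∀ x ∈ st.1, x ∈ X) ∧ st.1.card = m) ∧ ((∀ x ∈ st.2, x ∈ X) ∧ st.2.card = l) ∧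
      (st.1.map φ).sum - (st.2.map φ).sum = y := by
    intro y hy
    obtain ⟨a, ha, b, hb, rfl⟩ := Finset.mem_sub.1 hy
    obtain ⟨s, hs, hsc, rfl⟩ := fr_mem_nsmul_image X φ m a ha
    obtain ⟨t, ht, htc, rfl⟩ := fr_mem_nsmul_image X φ l b hb
    exact ⟨(s, t), ⟨hs, hsc⟩, ⟨ht, htc⟩, rfl⟩
  choose! f hf1 hf2 hf3 using key
  refine Finset.card_le_card_of_injOn (fun y => (f y).1.sum - (f y).2.sum) ?_ ?_
  · intro y hy
    have e1 := fr_sum_mem_nsmul X id _ (hf1 y hy).1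
    have e2 := fr_sum_mem_nsmul X id _ (hf2 y hy).1
    rw [(hf1 y hy).2] at e1
    rw [(hf2 y hy).2] at e2
    simp only [Multiset.map_id, Finset.image_id] at e1 e2
    exact Finset.sub_mem_sub e1 e2
  · intro y hy z hz hyz
    dsimp only at hyz
    rw [← hf3 y hy, ← hf3 z hz]
    have := (h' ((f y).1 + (f z).2) ((f z).1 + (f y).2)
      (by intro x hx; rcases Multiset.mem_add.1 hx with hx | hx
          · exact (hf1 y hy).1 x hx
          · exact (hf2 z hz).1 x hx)
      (by intro x hx; rcases Multiset.mem_add.1 hx with hx | hx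
          · exact (hf1 z hz).1 x hx
          · exact (hf2 y hy).1 x hx)
      (by simp [(hf1 y hy).2, (hf2 z hz).2]) (by simp [(hf1 z hz).2, (hf2 y hy).2])).2
      (by simp only [Multiset.sum_add]; linarith)
    simp only [Multiset.map_add, Multiset.sum_add] at this
    rw [sub_eq_sub_iff_add_eq_add]
    exact this

lemma fr_abs_sum_le (g : ℤ → ℤ) (B : ℝ) (s : Multiset ℤ) (hs : ∀ x ∈ s, (|g x| : ℝ) ≤ B) :
    (|((s.map g).sum : ℤ)| : ℝ) ≤ s.card * B := by
  induction s using Multiset.induction_on with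
  | empty => simp
  | cons a s ih =>
    have h1 := ih fun x hx => hs x (Multiset.mem_cons_of_mem hx)
    have h2 := hs a (Multiset.mem_cons_self _ _)
    simp only [Multiset.map_cons, Multiset.sum_cons, Multiset.card_cons]
    push_cast at *
    refine (abs_add_le _ _).trans ?_
    linarith

lemma fr_cast_iff (p κ : ℕ) (g : ℤ → ℤ) (B : ℝ) (hB : 2 * κ * B < p) (s t : Multiset ℤ)
    (hs : ∀ x ∈ s, (|g x| : ℝ) ≤ B) (ht : ∀ x ∈ t, (|g x| : ℝ) ≤ B) (hsc : s.card = κ)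
    (htc : t.card = κ) :
    (s.map fun x => (g x : ZMod p)).sum = (t.map fun x => (g x : ZMod p)).sum ↔
      (s.map g).sum = (t.map g).sum := by
  have hc : ∀ s : Multiset ℤ, (s.map fun x => (g x : ZMod p)).sum = (((s.map g).sum : ℤ) : ZMod p) := by
    intro s
    have := map_multiset_sum (Int.castRingHom (ZMod p)) (s.map g)
    rw [Multiset.map_map] at this
    exact this.symm
  rw [hc, hc]
  constructor
  · intro h
    rw [ZMod.intCast_eq_intCast_iff_dvd_sub] at h
    by_contra hne
    have h1 := fr_abs_sum_le g B s hs
    have h2 := fr_abs_sum_le g B t ht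
    rw [hsc] at h1
    rw [htc] at h2
    have h3 := Int.le_of_dvd (abs_pos.2 (sub_ne_zero.2 (Ne.symm hne))) ((dvd_abs _ _).2 h)
    have h4 : (p:ℝ) ≤ |((t.map g).sum : ℝ) - ((s.map g).sum : ℝ)| := by exact_mod_cast h3
    have h5 := abs_sub (((t.map g).sum : ℤ) : ℝ) ((s.map g).sum : ℤ)
    push_cast at *
    linarith
  · intro h; rw [h]

open Finset in
lemma fr_rectify (X : Finset ℤ) (hX : X.Nonempty) (κ s i₀ : ℕ) (hκ : 6 ≤ κ) (hs : 1 ≤ s)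
    (hcov : #(3 • X - 2 • X) ≤ s * #X)
    (hi : 8 * κ * 2 ^ (2 * s) * (4 * s) ≤ 2 ^ i₀) :
    ∃ φ : ℤ → ℤ, FrIso κ X φ ∧
      ∀ x ∈ X, 2 * κ * |φ x| ≤ (2 * (2 ^ ((3 * i₀ + 2) * s) * #(X - X)) : ℕ) := by
  classical
  have hex : ∃ L : ℕ, ∃ φ : ℤ → ℤ, FrIso κ X φ ∧ ∀ x ∈ X, |φ x| ≤ L := by
    refine ⟨∑ x ∈ X, x.natAbs, id, ?_, ?_⟩
    · intro s t _ _ _ _; simp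
    · intro x hx
      have : x.natAbs ≤ ∑ x ∈ X, x.natAbs :=
        Finset.single_le_sum (f := fun x : ℤ => x.natAbs) (fun _ _ => Nat.zero_le _) hx
      simp only [id]
      rw [Int.abs_eq_natAbs]
      exact_mod_cast this
  obtain ⟨φ, hφ, hL⟩ := Nat.find_spec hex
  have hmin := fun m => @Nat.find_min _ _ hex m
  set L := Nat.find hex with hLdef
  set W : ℕ := 2 * (2 ^ ((3 * i₀ + 2) * s) * #(X - X)) with hW
  refine ⟨φ, hφ, fun x hx => ?_⟩
  suffices 2 * κ * L ≤ W by
    have h1 := hL x hx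
    have h2 : ((2 * κ * L : ℕ) : ℤ) ≤ W := by exact_mod_cast this
    push_cast at h2
    refine le_trans ?_ h2
    gcongr
  by_contra! hcon
  have hLpos : 0 < L := by
    rcases Nat.eq_zero_or_pos L with h | h
    · rw [h] at hcon; simp at hcon
    · exact h
  obtain ⟨p, hp, hp1, hp2⟩ := Nat.exists_prime_lt_and_le_two_mul (2 * κ * L) (by positivity)
  have : Fact p.Prime := ⟨hp⟩
  set ψ : ℤ → ZMod p := fun x => (φ x : ZMod p) with hψ
  have hp1' : (2:ℝ) * κ * L < p := by exact_mod_cast hp1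
  have hp2' : (p:ℝ) ≤ 2 * (2 * κ * L) := by exact_mod_cast hp2
  have hLr : ∀ x ∈ X, (|φ x| : ℝ) ≤ (L:ℝ) := by intro x hx; exact_mod_cast hL x hx
  have hψiso : FrIso κ X ψ := by
    intro s t hs ht hsc htc
    rw [← hφ s t hs ht hsc htc]
    exact fr_cast_iff p κ φ L hp1' s t (fun x hx => hLr x (hs x hx)) (fun x hx => hLr x (ht x hx)) hsc htc
  set X' := X.image ψ with hX'
  have hX'ne : X'.Nonempty := hX.image ψ
  have hX'card : #X' = #X := by
    apply Finset.card_image_of_injOn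
    intro a ha b hb hab
    have := hψiso.mono hX (show 1 ≤ κ by omega) {a} {b} (by simpa using ha) (by simpa using hb) rfl rfl
    simpa using this.1 (by simpa using hab)
  set H := X' - X' with hH
  obtain ⟨x₀, hx₀⟩ := hX
  have h0 : (0 : ZMod p) ∈ H := by
    have : ψ x₀ ∈ X' := Finset.mem_image_of_mem _ hx₀
    exact Finset.mem_sub.2 ⟨_, this, _, this, sub_self _⟩
  have hHc : #H ≤ #(X - X) := by
    have := hψiso.card_le ⟨x₀, hx₀⟩ (m := 1) (l := 1) (by omega)
    simpa using this
  have hHH : (H + H) + X' = 3 • X' - 2 • X' := by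
    rw [hH, show (3 : ℕ) • X' = X' + X' + X' by rw [succ_nsmul X' 2, two_nsmul], two_nsmul]
    simp only [sub_eq_add_neg, neg_add]
    generalize -X' = Z
    ac_rfl
  obtain ⟨F, _, hF1, hF2⟩ := Finset.ruzsa_covering_add (A := H + H) (B := X') (K := (s:ℝ)) hX'ne (by
    rw [hHH]
    have h1 := hψiso.card_le ⟨x₀, hx₀⟩ (m := 3) (l := 2) (by omega)
    have h2 : #(3 • X' - 2 • X') ≤ s * #X' := by rw [hX'card]; exact h1.trans hcov
    exact_mod_cast h2)
  obtain ⟨q, hq, hall⟩ := fr_dilate F H s κ i₀ hs (by omega) h0 (by exact_mod_cast hF1) hF2 hi (by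
    have : 2 * (2 ^ ((3 * i₀ + 2) * s) * #H) ≤ W := by rw [hW]; gcongr
    omega)
  have hκ0 : (0:ℝ) < κ := by exact_mod_cast (by omega : 0 < κ)
  set φ' : ℤ → ℤ := fun x => (q * (ψ x - ψ x₀)).valMinAbs with hφ'
  have hφ'b : ∀ x ∈ X, (|φ' x| : ℝ) ≤ p / (8 * κ) := fun x hx =>
    hall _ (Finset.sub_mem_sub (Finset.mem_image_of_mem _ hx) (Finset.mem_image_of_mem _ hx₀))
  have hbig : 2 * κ * ((p:ℝ) / (8 * κ)) < p := by
    have hp0 : (0:ℝ) < p := by exact_mod_cast hp.pos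
    have : 2 * κ * ((p:ℝ) / (8 * κ)) = p / 4 := by field_simp; norm_num
    linarith
  have hsum : ∀ s : Multiset ℤ, s.card = κ →
      (s.map fun x => (φ' x : ZMod p)).sum = q * (s.map ψ).sum - κ • (q * ψ x₀) := by
    intro s hs
    have : ∀ x, ((φ' x : ℤ) : ZMod p) = q * ψ x - q * ψ x₀ := by
      intro x; simp only [hφ', ZMod.coe_valMinAbs, mul_sub]
    simp_rw [this]
    rw [Multiset.sum_map_sub, Multiset.sum_map_mul_left, Multiset.map_const', Multiset.sum_replicate, hs]
  refine hmin (L / 2) (by omega) ⟨φ', ?_, ?_⟩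
  · intro s t hs ht hsc htc
    rw [← hψiso s t hs ht hsc htc, ← fr_cast_iff p κ φ' _ hbig s t (fun x hx => hφ'b x (hs x hx))
      (fun x hx => hφ'b x (ht x hx)) hsc htc, hsum s hsc, hsum t htc]
    rw [sub_left_inj, mul_right_inj' hq]
  · intro x hx
    have h1 := hφ'b x hx
    have h2 : (p:ℝ) / (8 * κ) ≤ L / 2 := by
      rw [div_le_iff₀ (by positivity)]
      linarith
    have h3 : 2 * |(φ' x : ℝ)| ≤ L := by linarith
    have h4 : 2 * |φ' x| ≤ (L:ℤ) := by exact_mod_cast h3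
    have h5 : |φ' x| ≤ (L:ℤ) / 2 := by omega
    exact_mod_cast h5

open Finset in
lemma fr_pl (A B : Finset ℤ) (K n : ℝ) (hA : A.Nonempty) (hK : 0 ≤ K) (h : (#(A + B) : ℝ) ≤ K * n)
    (hn : n ≤ #A) (l m : ℕ) : (#(l • B - m • B) : ℝ) ≤ K ^ (l + m) * #A := by
  have h1 := Finset.pluennecke_ruzsa_inequality_nsmul_sub_nsmul_add hA B l m
  have h2 : (#(l • B - m • B) : ℝ) ≤ ((#(A + B) : ℝ) / #A) ^ (l + m) * #A := by
    have h3 := (NNRat.cast_le (K := ℝ)).2 h1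
    push_cast at h3
    exact h3
  refine h2.trans ?_
  have hA' : (0:ℝ) < #A := by exact_mod_cast hA.card_pos
  have : (#(A + B) : ℝ) / #A ≤ K := by
    rw [div_le_iff₀ hA']
    exact h.trans (by gcongr)
  gcongr

open Finset in
lemma fr_pluennecke (A B : Finset ℤ) (K n : ℝ) (hA : A.Nonempty) (hB : B.Nonempty) (hK : 2 ≤ K)
    (h : (#(A + B) : ℝ) ≤ K * n) (hnA : n ≤ #A) (hnB : n ≤ #B) (a : ℕ) (ha : 1 ≤ a) :
    (#(a • (A ∪ B) - a • (A ∪ B)) : ℝ) ≤ K ^ (9 * a) * n := by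
  obtain ⟨a₀, ha₀⟩ := id hA
  obtain ⟨b₀, hb₀⟩ := id hB
  have hA' : (0:ℝ) < #A := by exact_mod_cast hA.card_pos
  have hB' : (0:ℝ) < #B := by exact_mod_cast hB.card_pos
  have hAB : (0:ℝ) < #(A + B) := by exact_mod_cast (hA.add hB).card_pos
  have hn : 0 < n := by
    by_contra! hcon
    have : K * n ≤ 0 := mul_nonpos_of_nonneg_of_nonpos (by linarith) hcon
    linarith
  have key : ∀ m : ℕ, ∀ y ∈ m • (A ∪ B), ∃ i : ℕ, i ≤ m ∧
      y + m * a₀ + i * (b₀ - a₀) ∈ m • A + m • B := by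
    intro m
    induction m with
    | zero => intro y hy; refine ⟨0, le_rfl, ?_⟩; simpa using hy
    | succ m ih =>
      intro y hy
      rw [succ_nsmul] at hy
      obtain ⟨z, hz, x, hx, rfl⟩ := Finset.mem_add.1 hy
      obtain ⟨i, hi, hmem⟩ := ih z hz
      have e : (m + 1) • A + (m + 1) • B = (m • A + m • B) + (A + B) := by
        rw [succ_nsmul, succ_nsmul]; ac_rfl
      rw [e]
      rcases Finset.mem_union.1 hx with hx | hx
      · refine ⟨i + 1, by omega, ?_⟩
        have := Finset.add_mem_add hmem (Finset.add_mem_add hx hb₀)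
        convert this using 1
        push_cast; ring
      · refine ⟨i, by omega, ?_⟩
        have := Finset.add_mem_add hmem (Finset.add_mem_add ha₀ hx)
        convert this using 1
        push_cast; ring
  set P := a • A - a • A with hP
  set Q := a • B - a • B with hQ
  set T := (Finset.Icc (-(a:ℤ)) a).image (fun j => j * (b₀ - a₀)) with hT
  have hTc : #T ≤ 2 * a + 1 := by
    refine Finset.card_image_le.trans ?_
    rw [Int.card_Icc]; omega
  have hsub : a • (A ∪ B) - a • (A ∪ B) ⊆ (P + Q) + T := by
    intro y hy
    obtain ⟨u, hu, v, hv, rfl⟩ := Finset.mem_sub.1 hy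
    obtain ⟨i, hi, hiu⟩ := key a u hu
    obtain ⟨j, hj, hjv⟩ := key a v hv
    have h1 := Finset.sub_mem_sub hiu hjv
    have e : (a • A + a • B) - (a • A + a • B) = P + Q := by
      rw [hP, hQ]; exact add_sub_add_comm _ _ _ _
    rw [e] at h1
    have h2 : ((j:ℤ) - i) * (b₀ - a₀) ∈ T :=
      Finset.mem_image.2 ⟨(j:ℤ) - i, by rw [Finset.mem_Icc]; omega, rfl⟩
    have := Finset.add_mem_add h1 h2
    convert this using 1
    ring
  have hPA : (#(P - A) : ℝ) ≤ K ^ (2 * a + 1) * #B := by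
    have e : P - A = a • A - (a + 1) • A := by
      rw [hP, succ_nsmul, sub_sub]
    rw [e]
    have := fr_pl B A K n hB (by linarith) (by rw [add_comm]; exact h) hnB a (a + 1)
    rwa [show a + (a + 1) = 2 * a + 1 by ring] at this
  have hBQ : (#(B - Q) : ℝ) ≤ K ^ (2 * a + 1) * #A := by
    have e : B - Q = (a + 1) • B - a • B := by
      rw [hQ, succ_nsmul]
      simp only [sub_eq_add_neg, neg_add, neg_neg]
      ac_rfl
    rw [e]
    have := fr_pl A B K n hA (by linarith) h hnA (a + 1) a
    rwa [show a + 1 + a = 2 * a + 1 by ring] at this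
  have t1 : (#(P + Q) : ℝ) * #A ≤ #(P - A) * #(A - Q) := by
    exact_mod_cast Finset.ruzsa_triangle_inequality_add_sub_sub P A Q
  have t2 : (#(A - Q) : ℝ) * #B ≤ #(A + B) * #(B - Q) := by
    exact_mod_cast Finset.ruzsa_triangle_inequality_sub_add_sub A B Q
  have hPQ : (#(P + Q) : ℝ) ≤ K ^ (4 * a + 3) * n := by
    have : (#(P + Q) : ℝ) * (#A * #B) ≤ (K ^ (4 * a + 3) * n) * (#A * #B) := by
      calc (#(P + Q) : ℝ) * (#A * #B) = (#(P + Q) * #A) * #B := by ring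
        _ ≤ (#(P - A) * #(A - Q)) * #B := by gcongr
        _ = #(P - A) * (#(A - Q) * #B) := by ring
        _ ≤ #(P - A) * (#(A + B) * #(B - Q)) := by gcongr
        _ ≤ (K ^ (2 * a + 1) * #B) * ((K * n) * (K ^ (2 * a + 1) * #A)) := by gcongr
        _ = _ := by ring
    exact le_of_mul_le_mul_right this (by positivity)
  have h2a : ((2 * a + 1 : ℕ) : ℝ) ≤ K ^ (2 * a) := by
    have h1 : ∀ a : ℕ, 1 ≤ a → 2 * a + 1 ≤ 2 ^ (2 * a) := by
      intro a ha
      induction a, ha using Nat.le_induction with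
      | base => norm_num
      | succ a ha ih => rw [show 2 * (a + 1) = 2 * a + 2 by ring, pow_add]; omega
    calc ((2 * a + 1 : ℕ) : ℝ) ≤ ((2 ^ (2 * a) : ℕ) : ℝ) := by exact_mod_cast h1 a ha
      _ = (2:ℝ) ^ (2 * a) := by push_cast; rfl
      _ ≤ _ := by gcongr
  calc (#(a • (A ∪ B) - a • (A ∪ B)) : ℝ) ≤ #((P + Q) + T) := by exact_mod_cast Finset.card_le_card hsub
    _ ≤ #(P + Q) * #T := by exact_mod_cast Finset.card_add_le
    _ ≤ (K ^ (4 * a + 3) * n) * (2 * a + 1 : ℕ) := by gcongr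
    _ ≤ (K ^ (4 * a + 3) * n) * K ^ (2 * a) := by gcongr
    _ = K ^ (6 * a + 3) * n := by rw [show 6 * a + 3 = (4 * a + 3) + 2 * a by ring, pow_add]; ring
    _ ≤ K ^ (9 * a) * n := by
      gcongr
      · linarith
      · omega

open Finset in
lemma nt_prod (I : ℕ) (hI : 1 ≤ I) :
    ∏ p ∈ Nat.primesBelow (2 ^ I), (1 - (p:ℝ)⁻¹)⁻¹ ≤ (I:ℝ) ^ 16 := by
  induction I, hI using Nat.le_induction with
  | base => 
    have : Nat.primesBelow (2 ^ 1) = ∅ := by decide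
    rw [this]; simp
  | succ I hI ih =>
    set S := (Nat.primesBelow (2 ^ (I + 1))).filter (fun p => 2 ^ I ≤ p) with hS
    have hfac : ∀ p : ℕ, p.Prime → 0 < (1 - (p:ℝ)⁻¹)⁻¹ ∧ (1 - (p:ℝ)⁻¹)⁻¹ ≤ Real.exp (2 * (p:ℝ)⁻¹) := by
      intro p hp
      have h2 : (2:ℝ) ≤ p := by exact_mod_cast hp.two_le
      have ht : (p:ℝ)⁻¹ ≤ 1 / 2 := by rw [one_div]; exact inv_anti₀ (by norm_num) h2
      have ht0 : 0 < (p:ℝ)⁻¹ := by positivity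
      set t := (p:ℝ)⁻¹
      have h1 : 0 < 1 - t := by linarith
      refine ⟨by positivity, ?_⟩
      refine le_trans ?_ (Real.add_one_le_exp _)
      rw [inv_le_iff_one_le_mul₀ h1]
      nlinarith
    have hsplit : ∏ p ∈ Nat.primesBelow (2 ^ (I + 1)), (1 - (p:ℝ)⁻¹)⁻¹ =
        (∏ p ∈ Nat.primesBelow (2 ^ I), (1 - (p:ℝ)⁻¹)⁻¹) * ∏ p ∈ S, (1 - (p:ℝ)⁻¹)⁻¹ := by
      rw [← Finset.prod_filter_not_mul_prod_filter (Nat.primesBelow (2 ^ (I + 1))) (fun p => 2 ^ I ≤ p)]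
      congr 2
      ext p
      simp only [Finset.mem_filter, Nat.mem_primesBelow, not_le]
      have : 2 ^ I ≤ 2 ^ (I + 1) := Nat.pow_le_pow_right (by norm_num) (by omega)
      constructor
      · rintro ⟨⟨_, h2⟩, h3⟩; exact ⟨h3, h2⟩
      · rintro ⟨h3, h2⟩; exact ⟨⟨by omega, h2⟩, h3⟩
    have hcount : I * #S ≤ 4 * 2 ^ I := by
      have h1 : (2 ^ I) ^ #S ≤ ∏ p ∈ S, p :=
        Finset.pow_card_le_prod _ _ _ fun p hp => (Finset.mem_filter.1 hp).2
      have h2 : ∏ p ∈ S, p ≤ primorial (2 ^ (I + 1)) := by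
        unfold primorial
        apply Finset.prod_le_prod_of_subset_of_one_le'
        · intro p hp
          have := Nat.mem_primesBelow.1 (Finset.mem_filter.1 hp).1
          simp only [Finset.mem_filter, Finset.mem_range]
          exact ⟨by omega, this.2⟩
        · intro p hp _
          exact (Finset.mem_filter.1 hp).2.one_le
      have h3 := primorial_le_four_pow (2 ^ (I + 1))
      have h4 : 2 ^ (I * #S) ≤ 2 ^ (4 * 2 ^ I) := by
        calc 2 ^ (I * #S) = (2 ^ I) ^ #S := pow_mul _ _ _
          _ ≤ 4 ^ (2 ^ (I + 1)) := h1.trans (h2.trans h3)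
          _ = (2 ^ 2) ^ (2 ^ (I + 1)) := by norm_num
          _ = 2 ^ (4 * 2 ^ I) := by rw [← pow_mul]; congr 1; ring
      exact (Nat.pow_le_pow_iff_right (by norm_num)).1 h4
    have hIpos : (0:ℝ) < I := by exact_mod_cast hI
    have hSprod : ∏ p ∈ S, (1 - (p:ℝ)⁻¹)⁻¹ ≤ Real.exp (8 / I) := by
      calc ∏ p ∈ S, (1 - (p:ℝ)⁻¹)⁻¹ ≤ ∏ p ∈ S, Real.exp (2 * ((2:ℝ) ^ I)⁻¹) := by
            apply Finset.prod_le_prod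
            · intro p hp
              exact (hfac p (Nat.mem_primesBelow.1 (Finset.mem_filter.1 hp).1).2).1.le
            · intro p hp
              refine (hfac p (Nat.mem_primesBelow.1 (Finset.mem_filter.1 hp).1).2).2.trans ?_
              have : ((2:ℝ) ^ I) ≤ p := by exact_mod_cast (Finset.mem_filter.1 hp).2
              gcongr
        _ = Real.exp (#S * (2 * ((2:ℝ) ^ I)⁻¹)) := by
            rw [Finset.prod_const, ← Real.exp_nat_mul]
        _ ≤ Real.exp (8 / I) := by
            apply Real.exp_le_exp.2
            have : (I:ℝ) * #S ≤ 4 * 2 ^ I := by exact_mod_cast hcount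
            have h2 : (0:ℝ) < 2 ^ I := by positivity
            rw [le_div_iff₀ hIpos]
            have : #S * (2 * ((2:ℝ) ^ I)⁻¹) * I = (2 * (I * #S)) / 2 ^ I := by field_simp
            rw [this, div_le_iff₀ h2]; linarith
    have hexp : Real.exp (8 / I) ≤ (((I + 1 : ℕ) : ℝ) / I) ^ 16 := by
      have hq : (0:ℝ) < ((I + 1 : ℕ) : ℝ) / I := by positivity
      rw [← Real.exp_log (pow_pos hq 16)]
      apply Real.exp_le_exp.2
      rw [Real.log_pow]
      have h1 := Real.one_sub_inv_le_log_of_pos hq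
      have h2 : 1 / (2 * (I:ℝ)) ≤ 1 - (((I + 1 : ℕ) : ℝ) / I)⁻¹ := by
        rw [inv_div]; push_cast
        have h3 : 1 - (I:ℝ) / (I + 1) = 1 / (I + 1) := by field_simp; ring
        rw [h3]
        have : (1:ℝ) ≤ I := by exact_mod_cast hI
        gcongr
        linarith
      have h4 : 8 / (I:ℝ) = 16 * (1 / (2 * (I:ℝ))) := by field_simp; norm_num
      rw [h4]; push_cast
      push_cast at h1 h2
      linarith
    rw [hsplit]
    calc _ ≤ (I:ℝ) ^ 16 * (((I + 1 : ℕ) : ℝ) / I) ^ 16 := by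
          apply mul_le_mul ih (hSprod.trans hexp)
          · apply Finset.prod_nonneg
            intro p hp
            exact (hfac p (Nat.mem_primesBelow.1 (Finset.mem_filter.1 hp).1).2).1.le
          · positivity
      _ = _ := by rw [← mul_pow]; congr 1; field_simp

noncomputable def invHom : ℕ →* ℝ where
  toFun n := (n:ℝ)⁻¹
  map_one' := by simp
  map_mul' a b := by push_cast; rw [mul_inv]

def roughSet (z x : ℕ) : Finset ℕ :=
  (Finset.Icc 1 x).filter (fun N => ∀ p ∈ N.primeFactorsList, z ≤ p)

lemma mem_roughSet {z x N : ℕ} : N ∈ roughSet z x ↔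
    (1 ≤ N ∧ N ≤ x) ∧ ∀ p, p.Prime → p ∣ N → z ≤ p := by
  unfold roughSet
  rw [Finset.mem_filter, Finset.mem_Icc]
  refine and_congr_right fun h => ?_
  constructor
  · intro h2 p hp hd; exact h2 p ((Nat.mem_primeFactorsList (by omega)).2 ⟨hp, hd⟩)
  · intro h2 p hp
    rw [Nat.mem_primeFactorsList (by omega)] at hp
    exact h2 p hp.1 hp.2

lemma nt_decomp (z n : ℕ) (hn : n ≠ 0) : ∃ a b : ℕ, n = a * b ∧
    (∀ p, p.Prime → p ∣ a → z ≤ p) ∧ (∀ p, p.Prime → p ∣ b → p < z) := by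
  induction n using Nat.recOnMul with
  | zero => exact absurd rfl hn
  | one => exact ⟨1, 1, rfl, fun p hp h => absurd (Nat.dvd_one.1 h) hp.one_lt.ne',
      fun p hp h => absurd (Nat.dvd_one.1 h) hp.one_lt.ne'⟩
  | prime p hp =>
    by_cases h : z ≤ p
    · refine ⟨p, 1, by simp, ?_, fun p hp h => absurd (Nat.dvd_one.1 h) hp.one_lt.ne'⟩
      intro q hq hd
      rwa [(Nat.prime_dvd_prime_iff_eq hq hp).1 hd]
    · refine ⟨1, p, by simp, fun p hp h => absurd (Nat.dvd_one.1 h) hp.one_lt.ne', ?_⟩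
      intro q hq hd
      rw [(Nat.prime_dvd_prime_iff_eq hq hp).1 hd]; omega
  | mul m n ihm ihn =>
    obtain ⟨a, b, h1, h2, h3⟩ := ihm (left_ne_zero_of_mul hn)
    obtain ⟨c, d, g1, g2, g3⟩ := ihn (right_ne_zero_of_mul hn)
    refine ⟨a * c, b * d, by rw [h1, g1]; ring, ?_, ?_⟩
    · intro p hp hd
      rcases (hp.dvd_mul).1 hd with h | h
      · exact h2 p hp h
      · exact g2 p hp h
    · intro p hp hd
      rcases (hp.dvd_mul).1 hd with h | h
      · exact h3 p hp h
      · exact g3 p hp h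

open Finset in
lemma nt_harm (z y : ℕ) : Real.log ((y + 1 : ℕ) : ℝ) ≤
    (∑ m ∈ roughSet z y, (m:ℝ)⁻¹) * ∏ p ∈ Nat.primesBelow z, (1 - (p:ℝ)⁻¹)⁻¹ := by
  have h0 : Real.log ((y + 1 : ℕ) : ℝ) ≤ ∑ n ∈ Finset.Icc 1 y, (n:ℝ)⁻¹ := by
    have := log_add_one_le_harmonic y
    rw [harmonic_eq_sum_Icc] at this
    push_cast at this ⊢
    exact this
  refine h0.trans ?_
  obtain ⟨hsum1, hsum⟩ := EulerProduct.summable_and_hasSum_smoothNumbers_prod_primesBelow_geometric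
    (f := invHom) (by
      intro p hp
      change ‖((p:ℝ))⁻¹‖ < 1
      rw [norm_inv, Real.norm_natCast]
      exact inv_lt_one_of_one_lt₀ (by exact_mod_cast hp.one_lt)) z
  set S := (Finset.Icc 1 y).filter (fun b => b ∈ Nat.smoothNumbers z) with hS
  have hSle : ∑ b ∈ S, (b:ℝ)⁻¹ ≤ ∏ p ∈ Nat.primesBelow z, (1 - (p:ℝ)⁻¹)⁻¹ := by
    have h1 : ∑ b ∈ S.subtype (· ∈ Nat.smoothNumbers z), invHom (b:ℕ) = ∑ b ∈ S, (b:ℝ)⁻¹ := by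
      have := Finset.sum_subtype_of_mem (s := S) (fun b => invHom b) (p := (· ∈ Nat.smoothNumbers z))
        (fun x hx => (Finset.mem_filter.1 hx).2)
      exact this
    rw [← h1]
    refine sum_le_hasSum _ (fun b _ => ?_) hsum
    change (0:ℝ) ≤ ((b:ℕ):ℝ)⁻¹
    positivity
  refine le_trans ?_ (mul_le_mul_of_nonneg_left hSle (Finset.sum_nonneg fun _ _ => by positivity))
  rw [Finset.sum_mul_sum, ← Finset.sum_product']
  have : ∀ n ∈ Finset.Icc 1 y, ∃ ab : ℕ × ℕ, n = ab.1 * ab.2 ∧ ab ∈ roughSet z y ×ˢ S := by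
    intro n hn
    rw [Finset.mem_Icc] at hn
    obtain ⟨a, b, h1, h2, h3⟩ := nt_decomp z n (by omega)
    have hab : 0 < a * b := by omega
    have ha : 0 < a := Nat.pos_of_mul_pos_right hab
    have hb : 0 < b := Nat.pos_of_mul_pos_left hab
    refine ⟨(a, b), h1, Finset.mem_product.2 ⟨?_, ?_⟩⟩
    · rw [mem_roughSet]
      exact ⟨⟨ha, by nlinarith⟩, h2⟩
    · rw [hS, Finset.mem_filter, Finset.mem_Icc]
      exact ⟨⟨hb, by nlinarith⟩, Nat.mem_smoothNumbers'.2 h3⟩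
  choose! g hg1 hg2 using this
  have hinj : Set.InjOn g (Finset.Icc 1 y) := by
    intro a ha b hb hab
    rw [hg1 a ha, hg1 b hb, hab]
  calc ∑ n ∈ Finset.Icc 1 y, (n:ℝ)⁻¹ = ∑ n ∈ Finset.Icc 1 y, ((g n).1:ℝ)⁻¹ * ((g n).2:ℝ)⁻¹ := by
        refine Finset.sum_congr rfl fun n hn => ?_
        conv_lhs => rw [hg1 n hn]
        push_cast; rw [mul_inv]
    _ = ∑ x ∈ (Finset.Icc 1 y).image g, ((x.1:ℝ)⁻¹ * (x.2:ℝ)⁻¹) := by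
        rw [Finset.sum_image hinj]
    _ ≤ _ := by
        apply Finset.sum_le_sum_of_subset_of_nonneg
        · intro x hx
          obtain ⟨n, hn, rfl⟩ := Finset.mem_image.1 hx
          exact hg2 n hn
        · intro x _ _; positivity

lemma nt_theta (x : ℝ) (hx : 10 ^ 8 ≤ x) : x / 2 ≤ Chebyshev.theta x := by
  have h1 := Chebyshev.theta_ge' (x := x) (by linarith)
  set w := √(√x) with hw
  have hx0 : 0 ≤ x := by linarith
  have hs : √x = w ^ 2 := (Real.sq_sqrt (Real.sqrt_nonneg x)).symm
  have hx4 : x = w ^ 4 := by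
    rw [show w ^ 4 = (w ^ 2) ^ 2 by ring, ← hs, Real.sq_sqrt hx0]
  have hw100 : 100 ≤ w := by
    rw [hw]; apply Real.le_sqrt_of_sq_le; apply Real.le_sqrt_of_sq_le
    norm_num; linarith
  have hlog : Real.log x ≤ 4 * w := by
    rw [hx4, Real.log_pow]
    have := Real.log_le_self (show 0 ≤ w by linarith)
    push_cast; linarith
  have hlog2 : Real.log (x + 2) ≤ 4 * (2 * w) := by
    have : Real.log (x + 2) ≤ Real.log ((2 * w) ^ 4) := by
      apply Real.log_le_log (by linarith)
      have : (2 * w) ^ 4 = 16 * x := by rw [hx4]; ring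
      linarith
    rw [Real.log_pow] at this
    have h3 := Real.log_le_self (show 0 ≤ 2 * w by linarith)
    push_cast at this; linarith
  have hl2 := Real.log_two_gt_d9
  have h5 : 2 * √x * Real.log x ≤ 8 * w ^ 3 := by
    rw [hs]
    calc 2 * w ^ 2 * Real.log x ≤ 2 * w ^ 2 * (4 * w) := by gcongr
      _ = _ := by ring
  have h6 : 8 * w ^ 3 ≤ 0.08 * x := by
    rw [hx4]
    have : 0 ≤ w ^ 3 * (w - 100) := mul_nonneg (by positivity) (by linarith)
    nlinarith
  have h7 : 8 * w ≤ 0.01 * x := by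
    have : w * 100 ≤ w * w ^ 3 := by
      apply mul_le_mul_of_nonneg_left _ (by linarith)
      nlinarith [sq_nonneg w]
    have h8 : w ^ 3 ≥ 100 ^ 3 := by gcongr
    rw [hx4]
    nlinarith
  nlinarith

open Finset in
lemma nt_rough_count (I x : ℕ) (hI : 20 ≤ I) (hx : (2 ^ I) ^ 4 ≤ x) :
    (x:ℝ) ≤ 8 * (I:ℝ) ^ 16 * #(roughSet (2 ^ I) x) := by
  set z : ℕ := 2 ^ I with hz
  have hzbig : 2 ^ 20 ≤ z := Nat.pow_le_pow_right (by norm_num) hI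
  have hzbig' : (2:ℝ) ^ 20 ≤ z := by exact_mod_cast hzbig
  set y := x / z ^ 2 with hy
  have hzpos : 0 < z := by positivity
  have hxpos : 1 < x := by
    have : z ≤ z ^ 4 := Nat.le_self_pow (by norm_num) z
    have : 2 ^ 20 ≤ x := by omega
    omega
  have hxr : (1:ℝ) < x := by exact_mod_cast hxpos
  set R := roughSet z x with hR
  set Q : ℕ → Finset ℕ := fun m => (Nat.primesLE (x / m)).filter (fun p => z ≤ p) with hQ
  -- upper bound
  have hup : ∑ N ∈ R, ∑ p ∈ N.primeFactors, Real.log p ≤ #R * Real.log x := by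
    rw [← nsmul_eq_mul]
    refine Finset.sum_le_card_nsmul _ _ _ fun N hN => ?_
    have hN' := (mem_roughSet.1 hN).1
    rw [← Real.log_prod (fun p hp => by
      have := (Nat.prime_of_mem_primeFactors hp).pos
      positivity)]
    have h1 : ∏ p ∈ N.primeFactors, p ≤ x := (Nat.le_of_dvd (by omega) (Nat.prod_primeFactors_dvd N)).trans hN'.2
    have h2 : (∏ p ∈ N.primeFactors, (p:ℝ)) ≤ x := by
      have := (Nat.cast_le (α := ℝ)).2 h1
      rwa [Nat.cast_prod] at this
    apply Real.log_le_log _ h2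
    apply Finset.prod_pos
    intro p hp
    have := (Nat.prime_of_mem_primeFactors hp).pos
    positivity
  have hmid : ∑ m ∈ roughSet z y, ∑ p ∈ Q m, Real.log p ≤ ∑ N ∈ R, ∑ p ∈ N.primeFactors, Real.log p := by
    rw [Finset.sum_sigma', Finset.sum_sigma']
    set f : (_ : ℕ) × ℕ → (_ : ℕ) × ℕ := fun a => ⟨a.1 * a.2, a.2⟩ with hf
    have hmem : ∀ a ∈ (roughSet z y).sigma Q, (1 ≤ a.1 ∧ a.1 ≤ y) ∧ (∀ p, p.Prime → p ∣ a.1 → z ≤ p) ∧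
        a.2 ≤ x / a.1 ∧ a.2.Prime ∧ z ≤ a.2 := by
      intro a ha
      rw [Finset.mem_sigma, mem_roughSet] at ha
      obtain ⟨⟨h1, h2⟩, h3⟩ := ha
      rw [hQ] at h3
      simp only [Finset.mem_filter, Nat.mem_primesLE] at h3
      exact ⟨h1, h2, h3.1.1, h3.1.2, h3.2⟩
    have hinj : Set.InjOn f ((roughSet z y).sigma Q) := by
      rintro ⟨m, p⟩ ha ⟨m', p'⟩ hb hab
      have hp := (hmem _ ha).2.2.2.1
      simp only [hf, Sigma.mk.injEq, heq_eq_eq] at hab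
      obtain ⟨h1, rfl⟩ := hab
      have := Nat.eq_of_mul_eq_mul_right hp.pos h1
      rw [this]
    calc ∑ a ∈ (roughSet z y).sigma Q, Real.log a.2 = ∑ b ∈ ((roughSet z y).sigma Q).image f, Real.log b.2 := by
          rw [Finset.sum_image hinj]
      _ ≤ _ := by
        apply Finset.sum_le_sum_of_subset_of_nonneg
        · intro b hb
          obtain ⟨⟨m, p⟩, ha, rfl⟩ := Finset.mem_image.1 hb
          obtain ⟨⟨h1, h2⟩, h3, h4, h5, h6⟩ := hmem _ ha
          dsimp only at h1 h2 h3 h4 h5 h6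
          have hle : m * p ≤ x := by
            rw [mul_comm]; exact (Nat.le_div_iff_mul_le h1).1 h4
          have hpos : 1 ≤ m * p := Nat.mul_pos h1 h5.pos
          rw [Finset.mem_sigma, hR, mem_roughSet]
          refine ⟨⟨⟨hpos, hle⟩, ?_⟩, ?_⟩
          · intro q hq hd
            rcases (hq.dvd_mul).1 hd with h | h
            · exact h3 q hq h
            · rwa [(Nat.prime_dvd_prime_iff_eq hq h5).1 h]
          · simp only [hf, Nat.mem_primeFactors]
            exact ⟨h5, Dvd.intro_left m rfl, by omega⟩
        · intro b _ _
          exact Real.log_natCast_nonneg _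
  have hlow : ∀ m ∈ roughSet z y, (x:ℝ) / 4 * (m:ℝ)⁻¹ ≤ ∑ p ∈ Q m, Real.log p := by
    intro m hm
    obtain ⟨⟨h1, h2⟩, _⟩ := mem_roughSet.1 hm
    have hm0 : (0:ℝ) < m := by exact_mod_cast h1
    have hxm : (z:ℝ) ^ 2 ≤ x / m := by
      rw [le_div_iff₀ hm0]
      have : m * z ^ 2 ≤ x := (Nat.le_div_iff_mul_le (by positivity)).1 h2
      have : (m:ℝ) * z ^ 2 ≤ x := by exact_mod_cast this
      linarith
    have hz2 : (2:ℝ) ^ 20 * 2 ^ 20 ≤ (z:ℝ) ^ 2 := by rw [sq]; gcongr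
    have hth := nt_theta ((x:ℝ) / m) (by norm_num at hz2 ⊢; linarith)
    have hth2 := Chebyshev.theta_le_log4_mul_x (x := (z:ℝ)) (by positivity)
    have hl4 : Real.log 4 ≤ 2 := by
      rw [show (4:ℝ) = 2 ^ 2 by norm_num, Real.log_pow]
      have := Real.log_two_lt_d9
      push_cast; linarith
    rw [Chebyshev.theta_eq_sum_primesLE, Nat.floor_div_natCast, Nat.floor_natCast] at hth
    rw [Chebyshev.theta_eq_sum_primesLE, Nat.floor_natCast] at hth2
    have hsplit := Finset.sum_filter_add_sum_filter_not (Nat.primesLE (x / m)) (fun p => z ≤ p) (fun p => Real.log p)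
    have hrest : ∑ p ∈ (Nat.primesLE (x / m)).filter (fun p => ¬ z ≤ p), Real.log p ≤
        ∑ p ∈ Nat.primesLE z, Real.log p := by
      apply Finset.sum_le_sum_of_subset_of_nonneg
      · intro p hp
        rw [Finset.mem_filter, Nat.mem_primesLE] at hp
        rw [Nat.mem_primesLE]
        exact ⟨by omega, hp.1.2⟩
      · intro b _ _
        exact Real.log_natCast_nonneg _
    have hfin : Real.log 4 * z ≤ (x / m) / 4 := by
      have : Real.log 4 * z ≤ 2 * z := by gcongr
      nlinarith
    have : (x:ℝ) / 4 * (m:ℝ)⁻¹ = (x / m) / 4 := by field_simp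
    rw [this]
    simp only [hQ]
    linarith
  have hsum : (x:ℝ) / 4 * ∑ m ∈ roughSet z y, (m:ℝ)⁻¹ ≤ #R * Real.log x := by
    rw [Finset.mul_sum]
    exact (Finset.sum_le_sum hlow).trans (hmid.trans hup)
  have hharm := nt_harm z y
  have hprod := nt_prod I (by omega)
  rw [← hz] at hprod
  have hlogy : Real.log x ≤ 2 * Real.log ((y + 1 : ℕ) : ℝ) := by
    have h1 : x < (y + 1) * z ^ 2 := by
      have := Nat.lt_div_mul_add (a := x) (b := z ^ 2) (by positivity)
      rw [← hy] at this; nlinarith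
    have h2 : x ≤ (y + 1) ^ 2 := by
      by_contra! hc
      have : x * x < ((y + 1) * z ^ 2) * ((y + 1) * z ^ 2) := Nat.mul_lt_mul'' h1 h1
      have h3 : ((y + 1) * z ^ 2) * ((y + 1) * z ^ 2) = (y + 1) ^ 2 * z ^ 4 := by ring
      have h4 : (y + 1) ^ 2 * z ^ 4 ≤ x * x := Nat.mul_le_mul hc.le hx
      omega
    have h3 : (x:ℝ) ≤ ((y + 1 : ℕ) : ℝ) ^ 2 := by exact_mod_cast h2
    have := Real.log_le_log (by linarith) h3
    rw [Real.log_pow] at this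
    push_cast at this ⊢
    exact this
  set S := ∑ m ∈ roughSet z y, (m:ℝ)⁻¹ with hS
  have hS0 : 0 ≤ S := Finset.sum_nonneg fun _ _ => by positivity
  have h1 : Real.log x ≤ 2 * (S * (I:ℝ) ^ 16) :=
    hlogy.trans (by gcongr; exact hharm.trans (by gcongr))
  have hlx : 0 < Real.log x := Real.log_pos hxr
  have h2 : (x:ℝ) * Real.log x ≤ (8 * (I:ℝ) ^ 16 * #R) * Real.log x := by
    calc (x:ℝ) * Real.log x ≤ x * (2 * (S * (I:ℝ) ^ 16)) := by gcongr
      _ = 8 * (I:ℝ) ^ 16 * (x / 4 * S) := by ring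
      _ ≤ 8 * (I:ℝ) ^ 16 * (#R * Real.log x) := by gcongr
      _ = _ := by ring
  exact le_of_mul_le_mul_right h2 hlx


theorem nt_rough_dvd {z N N' e e' : ℕ} (hN : ∀ p, p.Prime → p ∣ N → z ≤ p)
    (he : 1 ≤ e') (hez : e' < z) (h : N * e = N' * e') : N ∣ N' := by
  have hc : Nat.Coprime N e' := by
    apply Nat.coprime_of_dvd
    intro p hp h1 h2
    have := hN p hp h1
    have := Nat.le_of_dvd he h2
    omega
  exact hc.dvd_of_dvd_mul_right ⟨e, h.symm⟩

theorem nt_case1 (J x : ℕ) (hJ : 1 ≤ J) (D : Finset ℤ) (h0 : (0:ℤ) ∉ D)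
    (hD : ∀ d ∈ D, |d| ≤ 2 ^ J * (x:ℤ)) (hx : 2 ^ 140 * (D.card + 1) * J ^ 17 ≤ x)
    (hbig : (2 ^ (200 * J)) ^ 4 ≤ x) :
    ∃ N : ℕ, 1 ≤ N ∧ N ≤ x ∧ ∀ d ∈ D, ¬ (N:ℤ) ∣ d := by
  by_contra! hcon
  obtain ⟨M, hM⟩ : ∃ M : ℕ, M = 16 * (200 * J) ^ 16 := ⟨_, rfl⟩
  have hM0 : 0 < M := by rw [hM]; positivity
  have hMle : M ≤ 2 ^ 132 * J ^ 16 := by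
    rw [hM, mul_pow, ← mul_assoc]
    exact Nat.mul_le_mul_right _ (by norm_num)
  have hMz : 2 ^ J * M < 2 ^ (200 * J) := by
    have h1 : J ^ 16 ≤ (2 ^ J) ^ 16 := Nat.pow_le_pow_left Nat.lt_two_pow_self.le 16
    calc 2 ^ J * M ≤ 2 ^ J * (2 ^ 132 * (2 ^ J) ^ 16) :=
          Nat.mul_le_mul_left _ (hMle.trans (Nat.mul_le_mul_left _ h1))
      _ = 2 ^ (17 * J + 132) := by rw [← pow_mul, ← pow_add, ← pow_add]; congr 1; ring
      _ < 2 ^ (200 * J) := Nat.pow_lt_pow_right (by norm_num) (by omega)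
  obtain ⟨R, hR⟩ : ∃ R, R = roughSet (2 ^ (200 * J)) x := ⟨_, rfl⟩
  have hcount : 2 * x ≤ M * R.card := by
    have := nt_rough_count (200 * J) x (by omega) hbig
    rw [← hR] at this
    have h2 : ((2 * x : ℕ) : ℝ) ≤ ((M * R.card : ℕ) : ℝ) := by
      rw [hM]; push_cast at this ⊢; linarith
    exact_mod_cast h2
  have hsplit := Finset.card_filter_add_card_filter_not (s := R) (fun N => x ≤ M * N)
  have hsmall : (R.filter (fun N => ¬ x ≤ M * N)).card ≤ x / M := by
    calc _ ≤ (Finset.Icc 1 (x / M)).card := by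
          apply Finset.card_le_card
          intro N hN
          rw [Finset.mem_filter, hR, mem_roughSet] at hN
          rw [Finset.mem_Icc]
          refine ⟨hN.1.1.1, ?_⟩
          rw [Nat.le_div_iff_mul_le hM0]
          have := hN.2
          rw [mul_comm]; omega
      _ = x / M := by simp
  have hinj : (R.filter (fun N => x ≤ M * N)).card ≤ D.card := by
    have hex : ∀ N : ℕ, ∃ d : ℤ, N ∈ R → d ∈ D ∧ (N:ℤ) ∣ d := by
      intro N
      by_cases hN : N ∈ R
      · rw [hR, mem_roughSet] at hN
        obtain ⟨d, hd, hd2⟩ := hcon N hN.1.1 hN.1.2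
        exact ⟨d, fun _ => ⟨hd, hd2⟩⟩
      · exact ⟨0, fun h => absurd h hN⟩
    choose f hf using hex
    have key : ∀ N ∈ R.filter (fun N => x ≤ M * N), ∃ e : ℕ, (f N).natAbs = N * e ∧ 1 ≤ e ∧ e < 2 ^ (200 * J) := by
      intro N hN
      rw [Finset.mem_filter] at hN
      obtain ⟨h1, h2⟩ := hf N hN.1
      obtain ⟨e, he⟩ := Int.natCast_dvd.1 h2
      have hne : (f N).natAbs ≠ 0 := by
        intro h; rw [Int.natAbs_eq_zero] at h; rw [h] at h1; exact h0 h1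
      have hNR := hN.1
      rw [hR, mem_roughSet] at hNR
      refine ⟨e, he, ?_, ?_⟩
      · rcases Nat.eq_zero_or_pos e with h | h
        · rw [h] at he; simp at he; omega
        · exact h
      · have h3 := hD _ h1
        rw [Int.abs_eq_natAbs, he] at h3
        have h4 : N * e ≤ 2 ^ J * x := by exact_mod_cast h3
        have h5 : N * e ≤ N * (2 ^ J * M) := by
          calc _ ≤ _ := h4
            _ ≤ 2 ^ J * (M * N) := Nat.mul_le_mul_left _ hN.2
            _ = _ := by ring
        exact (Nat.le_of_mul_le_mul_left h5 (by omega)).trans_lt hMz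
    apply Finset.card_le_card_of_injOn f
    · intro N hN
      exact (hf N (Finset.mem_filter.1 hN).1).1
    · intro N hN N' hN' h
      obtain ⟨e, h1, h2, h3⟩ := key N hN
      obtain ⟨e', h1', h2', h3'⟩ := key N' hN'
      have heq : N * e = N' * e' := by rw [← h1, ← h1', h]
      have hr := (Finset.mem_filter.1 hN).1
      have hr' := (Finset.mem_filter.1 hN').1
      rw [hR, mem_roughSet] at hr hr'
      exact Nat.dvd_antisymm (nt_rough_dvd hr.2 h2' h3' heq) (nt_rough_dvd hr'.2 h2 h3 heq.symm)
  have h6 : 2 * x ≤ M * (D.card + x / M) :=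
    hcount.trans (Nat.mul_le_mul_left _ (by omega))
  have h7 : M * (x / M) ≤ x := Nat.mul_div_le x M
  have h8 : x ≤ M * D.card := by rw [mul_add] at h6; omega
  have h9 : M * D.card < 2 ^ 140 * (D.card + 1) * J ^ 17 := by
    calc M * D.card ≤ 2 ^ 132 * J ^ 16 * D.card := Nat.mul_le_mul_right _ hMle
      _ = 2 ^ 132 * D.card * J ^ 16 := by ring
      _ < 2 ^ 140 * (D.card + 1) * J ^ 16 := Nat.mul_lt_mul_of_pos_right (by omega) (by positivity)
      _ ≤ _ := Nat.mul_le_mul_left _ (Nat.pow_le_pow_right hJ (by norm_num))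
  omega

theorem nt_case2 (J x : ℕ) (hJ : 1 ≤ J) (D : Finset ℤ) (h0 : (0:ℤ) ∉ D)
    (hD : ∀ d ∈ D, |d| ≤ 2 ^ J * (x:ℤ)) (hx : 2 ^ 140 * (D.card + 1) * J ^ 17 ≤ x)
    (hbig : x < 2 ^ (800 * J)) :
    ∃ N : ℕ, 1 ≤ N ∧ N ≤ x ∧ ∀ d ∈ D, ¬ (N:ℤ) ∣ d := by
  by_contra! hcon
  have hx1 : 2 ^ 140 ≤ x := by
    have : 1 ≤ (D.card + 1) * J ^ 17 := Nat.mul_pos (by omega) (by positivity)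
    calc 2 ^ 140 ≤ 2 ^ 140 * ((D.card + 1) * J ^ 17) := Nat.le_mul_of_pos_right _ this
      _ ≤ x := by rw [← mul_assoc]; exact hx
  have hup : (Nat.primesLE x).card ≤ D.card * (801 * J) := by
    calc _ ≤ (D.biUnion (fun d => d.natAbs.primeFactors)).card := by
          apply Finset.card_le_card
          intro p hp
          rw [Nat.mem_primesLE] at hp
          obtain ⟨d, hd, hd2⟩ := hcon p hp.2.pos hp.1
          rw [Finset.mem_biUnion]
          refine ⟨d, hd, ?_⟩
          rw [Nat.mem_primeFactors]
          refine ⟨hp.2, Int.natCast_dvd.1 hd2, ?_⟩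
          intro h; rw [Int.natAbs_eq_zero] at h; rw [h] at hd; exact h0 hd
      _ ≤ _ := by
          apply Finset.card_biUnion_le_card_mul
          intro d hd
          have hne : d.natAbs ≠ 0 := by
            intro h; rw [Int.natAbs_eq_zero] at h; rw [h] at hd; exact h0 hd
          have h1 : 2 ^ d.natAbs.primeFactors.card ≤ ∏ p ∈ d.natAbs.primeFactors, p :=
            Finset.pow_card_le_prod _ _ _ (fun p hp => (Nat.prime_of_mem_primeFactors hp).two_le)
          have h2 := Nat.le_of_dvd (Nat.pos_of_ne_zero hne) (Nat.prod_primeFactors_dvd d.natAbs)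
          have h3 := hD d hd
          rw [Int.abs_eq_natAbs] at h3
          have h4 : d.natAbs ≤ 2 ^ J * x := by exact_mod_cast h3
          have h5 : 2 ^ J * x < 2 ^ (801 * J) := by
            calc 2 ^ J * x < 2 ^ J * 2 ^ (800 * J) := Nat.mul_lt_mul_of_pos_left hbig (by positivity)
              _ = 2 ^ (801 * J) := by rw [← pow_add]; congr 1; ring
          exact ((Nat.pow_lt_pow_iff_right (by norm_num)).1 (h1.trans_lt ((h2.trans h4).trans_lt h5))).le
  rw [Nat.primesLE_card_eq_primeCounting] at hup
  have hpi := Chebyshev.pi_ge x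
  have hxR : (100:ℝ) ≤ x := by
    have : 100 ≤ x := le_trans (by norm_num) hx1
    exact_mod_cast this
  have hl0 : 0 < Real.log x := Real.log_pos (by linarith)
  rw [div_le_iff₀ hl0] at hpi
  have hl2 := Real.log_two_gt_d9
  have hl2' := Real.log_two_lt_d9
  have hlx : Real.log x ≤ 800 * J * Real.log 2 := by
    have h : (x:ℝ) ≤ 2 ^ (800 * J) := by exact_mod_cast hbig.le
    have := Real.log_le_log (by linarith) h
    rw [Real.log_pow] at this
    push_cast at this; linarith
  have hlx1 : Real.log (x + 1) ≤ x * Real.log 2 / 2 := by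
    have h1 := Real.log_le_sub_one_of_pos (x := ((x:ℝ) + 1) / 8) (by positivity)
    rw [Real.log_div (by positivity) (by norm_num)] at h1
    have h8 : Real.log 8 = 3 * Real.log 2 := by
      rw [show (8:ℝ) = 2 ^ 3 by norm_num, Real.log_pow]; norm_num
    rw [h8] at h1
    nlinarith
  have hpi2 : (x:ℝ) ≤ 1600 * J * Nat.primeCounting x := by
    have h1 : (Nat.primeCounting x : ℝ) * Real.log x ≤ Nat.primeCounting x * (800 * J * Real.log 2) :=
      mul_le_mul_of_nonneg_left hlx (by positivity)
    have h2 : (x:ℝ) * Real.log 2 ≤ (1600 * J * Nat.primeCounting x) * Real.log 2 := by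
      have : (x:ℝ) * Real.log 2 - x * Real.log 2 / 2 ≤ Nat.primeCounting x * (800 * J * Real.log 2) := by
        linarith
      linarith
    exact le_of_mul_le_mul_right h2 (by linarith)
  have hpi3 : x ≤ 1600 * J * Nat.primeCounting x := by exact_mod_cast hpi2
  have h9 : 1600 * J * (D.card * (801 * J)) < 2 ^ 140 * (D.card + 1) * J ^ 17 := by
    calc _ = 1600 * 801 * D.card * J ^ 2 := by ring
      _ < 2 ^ 140 * (D.card + 1) * J ^ 2 := Nat.mul_lt_mul_of_pos_right (by omega) (by positivity)
      _ ≤ _ := Nat.mul_le_mul_left _ (Nat.pow_le_pow_right hJ (by norm_num))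
  have := Nat.mul_le_mul_left (1600 * J) hup
  omega

theorem nt_main (J x : ℕ) (hJ : 1 ≤ J) (D : Finset ℤ) (h0 : (0:ℤ) ∉ D)
    (hD : ∀ d ∈ D, |d| ≤ 2 ^ J * (x:ℤ)) (hx : 2 ^ 140 * (D.card + 1) * J ^ 17 ≤ x) :
    ∃ N : ℕ, 1 ≤ N ∧ N ≤ x ∧ ∀ d ∈ D, ¬ (N:ℤ) ∣ d := by
  rcases lt_or_ge x (2 ^ (800 * J)) with h | h
  · exact nt_case2 J x hJ D h0 hD hx h
  · refine nt_case1 J x hJ D h0 hD hx ?_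
    rw [← pow_mul]
    have h2 : 200 * J * 4 = 800 * J := by ring
    rwa [h2]


open Finset in
lemma fr_to_zmod (X : Finset ℤ) (φ : ℤ → ℤ) (k N : ℕ) (h : FrIso k X φ)
    (hN : ∀ d ∈ (k • (X.image φ) - k • (X.image φ)).erase 0, ¬ (N:ℤ) ∣ d) :
    FrIso k X (fun x => (φ x : ZMod N)) := by
  intro s t hs ht hsc htc
  have hc : ∀ s : Multiset ℤ, (s.map fun x => (φ x : ZMod N)).sum = (((s.map φ).sum : ℤ) : ZMod N) := by
    intro s
    induction s using Multiset.induction_on with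
    | empty => simp
    | cons a s ih =>
      rw [Multiset.map_cons, Multiset.sum_cons, Multiset.map_cons, Multiset.sum_cons, Int.cast_add, ih]
  rw [← h s t hs ht hsc htc, hc, hc]
  constructor
  · intro he
    by_contra hne
    rw [ZMod.intCast_eq_intCast_iff_dvd_sub] at he
    refine hN _ ?_ he
    rw [Finset.mem_erase]
    refine ⟨sub_ne_zero.2 (Ne.symm hne), ?_⟩
    have e1 := fr_sum_mem_nsmul X φ s hs
    have e2 := fr_sum_mem_nsmul X φ t ht
    rw [hsc] at e1
    rw [htc] at e2
    exact Finset.sub_mem_sub e2 e1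
  · intro he
    rw [he]

lemma FrIso.injOn {G : Type*} [AddCommGroup G] {k : ℕ} {X : Finset ℤ} {φ : ℤ → G}
    (h : FrIso k X φ) (hX : X.Nonempty) (hk : 1 ≤ k) : Set.InjOn φ X := by
  intro a ha b hb hab
  have := h.mono hX hk {a} {b} (by simpa using ha) (by simpa using hb) rfl rfl
  simpa [hab] using this

lemma FrIso.iso {G : Type*} [AddCommGroup G] {k : ℕ} {X : Finset ℤ} {φ : ℤ → G}
    (h : FrIso k X φ) (hX : X.Nonempty) (hk : 1 ≤ k) :
    IsAddFreimanIso k (X : Set ℤ) (φ '' X) φ := by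
  refine ⟨(h.injOn hX hk).bijOn_image, ?_⟩
  intro s t hs ht hsc htc
  exact h s t (fun x hx => by simpa using hs hx) (fun x hx => by simpa using ht hx) hsc htc

open Finset in
lemma FrIso.card_add {G : Type*} [AddCommGroup G] [DecidableEq G] {k : ℕ} {A B : Finset ℤ} {φ : ℤ → G}
    (h : FrIso k (A ∪ B) φ) (hA : A.Nonempty) (hk : 2 ≤ k) :
    #(A.image φ + B.image φ) ≤ #(A + B) := by
  have h2 := h.mono (hA.mono subset_union_left) hk
  have key : ∀ y ∈ A.image φ + B.image φ, ∃ p : ℤ × ℤ, (p.1 ∈ A ∧ p.2 ∈ B) ∧ φ p.1 + φ p.2 = y := by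
    intro y hy
    obtain ⟨u, hu, v, hv, rfl⟩ := Finset.mem_add.1 hy
    obtain ⟨a, ha, rfl⟩ := Finset.mem_image.1 hu
    obtain ⟨b, hb, rfl⟩ := Finset.mem_image.1 hv
    exact ⟨(a, b), ⟨ha, hb⟩, rfl⟩
  choose! f hf1 hf2 using key
  refine Finset.card_le_card_of_injOn (fun y => (f y).1 + (f y).2) ?_ ?_
  · intro y hy
    exact Finset.add_mem_add (hf1 y hy).1 (hf1 y hy).2
  · intro y hy z hz hyz
    dsimp only at hyz
    have hm : ∀ w ∈ A.image φ + B.image φ, ∀ x ∈ ({(f w).1, (f w).2} : Multiset ℤ), x ∈ A ∪ B := by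
      intro w hw x hx
      have := hf1 w hw
      simp only [Multiset.insert_eq_cons, Multiset.mem_cons, Multiset.mem_singleton] at hx
      rw [Finset.mem_union]
      rcases hx with rfl | rfl
      · exact Or.inl this.1
      · exact Or.inr this.2
    have := (h2 {(f y).1, (f y).2} {(f z).1, (f z).2} (hm y hy) (hm z hz) rfl rfl).2
      (by simpa using hyz)
    rw [← hf2 y hy, ← hf2 z hz]
    simpa using this

lemma fr_num (K n : ℝ) (k s i₀ J W : ℕ) (hK : 2 ≤ K) (hk : 2 ≤ k) (hn : 0 ≤ n)
    (hs1 : 1 ≤ s) (hs : (s:ℝ) ≤ 2 * K ^ 27) (hi : i₀ = 3 * s + 3 * k + 5)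
    (hJ : J = (3 * i₀ + 2) * s + 1 + s) (hW : (W:ℝ) ≤ K ^ (9 * k) * n) :
    ((2 ^ 140 * W * J ^ 17 : ℕ) : ℝ) ≤ K ^ (623 * k) * n := by
  have hJ1 : J ≤ 64 * k * s ^ 2 := by
    subst hi; subst hJ
    obtain ⟨a, rfl⟩ := Nat.exists_eq_add_of_le hs1
    obtain ⟨b, rfl⟩ := Nat.exists_eq_add_of_le hk
    ring_nf
    nlinarith [Nat.zero_le (a * b), Nat.zero_le (a ^ 2 * b)]
  have hK1 : (1:ℝ) ≤ K := by linarith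
  have hs2 : (s:ℝ) ≤ K ^ 28 := by
    calc (s:ℝ) ≤ 2 * K ^ 27 := hs
      _ ≤ K * K ^ 27 := by gcongr
      _ = K ^ 28 := by ring
  have hk2 : (k:ℝ) ≤ K ^ k := by
    have : (k:ℝ) ≤ 2 ^ k := by exact_mod_cast Nat.lt_two_pow_self.le
    exact this.trans (by gcongr)
  have hJ2 : (J:ℝ) ≤ K ^ (62 + k) := by
    have : (J:ℝ) ≤ 64 * k * s ^ 2 := by exact_mod_cast hJ1
    calc (J:ℝ) ≤ 64 * k * s ^ 2 := this
      _ = 2 ^ 6 * k * s ^ 2 := by norm_num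
      _ ≤ K ^ 6 * K ^ k * (K ^ 28) ^ 2 := by gcongr
      _ = K ^ (62 + k) := by ring
  rw [Nat.cast_mul, Nat.cast_mul, Nat.cast_pow, Nat.cast_pow, Nat.cast_ofNat]
  calc (2:ℝ) ^ 140 * W * J ^ 17 ≤ K ^ 140 * (K ^ (9 * k) * n) * (K ^ (62 + k)) ^ 17 := by gcongr
    _ = K ^ (1194 + 26 * k) * n := by ring
    _ ≤ K ^ (623 * k) * n := by
      gcongr
      omega

open Finset in
lemma fr_final (A B : Finset ℤ) (K : ℝ) (k : ℕ) (hA : A.Nonempty) (hB : B.Nonempty) (hK : 2 ≤ K)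
    (hk : 2 ≤ k) (h : (#(A + B) : ℝ) ≤ K * min (#A : ℝ) (#B : ℝ)) :
    ∃ N : ℕ, 0 < N ∧ (N : ℝ) ≤ K ^ (623 * k) * min (#A : ℝ) (#B : ℝ) ∧
      ∃ ψ : ℤ → ZMod N, FrIso k (A ∪ B) ψ := by
  obtain ⟨m, hm⟩ : ∃ m : ℕ, m = min #A #B := ⟨_, rfl⟩
  have hmR : min (#A : ℝ) (#B : ℝ) = (m:ℝ) := by rw [hm]; push_cast; rfl
  rw [hmR] at h ⊢
  have hmA : m ≤ #A := by rw [hm]; exact min_le_left _ _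
  have hmB : m ≤ #B := by rw [hm]; exact min_le_right _ _
  have hm1 : 1 ≤ m := by rw [hm]; exact le_min hA.card_pos hB.card_pos
  have hpl := fr_pluennecke A B K m hA hB hK h (by exact_mod_cast hmA) (by exact_mod_cast hmB)
  obtain ⟨X, hX⟩ : ∃ X, X = A ∪ B := ⟨_, rfl⟩
  rw [← hX] at hpl ⊢
  have hXne : X.Nonempty := by rw [hX]; exact hA.mono subset_union_left
  have hmX : m ≤ #X := hmA.trans (by rw [hX]; exact card_le_card subset_union_left)
  have hK1 : (1:ℝ) ≤ K := by linarith
  obtain ⟨s, hs⟩ : ∃ s, s = ⌈K ^ 27⌉₊ := ⟨_, rfl⟩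
  have hK27 : (1:ℝ) ≤ K ^ 27 := one_le_pow₀ hK1
  have hsK : K ^ 27 ≤ s := by rw [hs]; exact Nat.le_ceil _
  have hs1 : 1 ≤ s := by
    have : (1:ℝ) ≤ s := hK27.trans hsK
    exact_mod_cast this
  have hs2 : (s:ℝ) ≤ 2 * K ^ 27 := by
    have := Nat.ceil_lt_add_one (a := K ^ 27) (by linarith)
    rw [← hs] at this; linarith
  have hcov : #(3 • X - 2 • X) ≤ s * #X := by
    have h1 : #(3 • X - 2 • X) ≤ #(3 • X - 3 • X) := by
      have : 3 • X - 3 • X = 3 • X - 2 • X - X := by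
        rw [show 3 • X = 2 • X + X from succ_nsmul X 2, sub_add_eq_sub_sub]
      rw [this]
      exact card_le_card_sub_right hXne
    have h2 := hpl 3 (by norm_num)
    have h3 : (#(3 • X - 3 • X) : ℝ) ≤ s * #X := by
      refine h2.trans ?_
      have : (m:ℝ) ≤ #X := by exact_mod_cast hmX
      norm_num
      gcongr
    have h4 : #(3 • X - 3 • X) ≤ s * #X := by exact_mod_cast h3
    exact h1.trans h4
  have hXX : #(X - X) ≤ 2 ^ s * m := by
    have h2 := hpl 1 le_rfl
    rw [one_nsmul] at h2
    have h3 : (#(X - X) : ℝ) ≤ s * m := by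
      refine h2.trans ?_
      gcongr
      exact (pow_le_pow_right₀ hK1 (by norm_num)).trans hsK
    have h4 : #(X - X) ≤ s * m := by exact_mod_cast h3
    exact h4.trans (Nat.mul_le_mul_right _ Nat.lt_two_pow_self.le)
  obtain ⟨i₀, hi⟩ : ∃ i₀, i₀ = 3 * s + 3 * k + 5 := ⟨_, rfl⟩
  obtain ⟨J, hJ⟩ : ∃ J, J = (3 * i₀ + 2) * s + 1 + s := ⟨_, rfl⟩
  have hi2 : 8 * (3 * k) * 2 ^ (2 * s) * (4 * s) ≤ 2 ^ i₀ := by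
    calc 8 * (3 * k) * 2 ^ (2 * s) * (4 * s) ≤ 8 * 2 ^ (3 * k) * 2 ^ (2 * s) * (4 * 2 ^ s) := by
          gcongr
          · exact Nat.lt_two_pow_self.le
          · exact Nat.lt_two_pow_self.le
      _ = 2 ^ i₀ := by rw [hi]; ring
  obtain ⟨φ, hφ, hφb⟩ := fr_rectify X hXne (3 * k) s i₀ (by omega) hs1 hcov hi2
  obtain ⟨W, hW⟩ : ∃ W, W = ⌊K ^ (9 * k) * m⌋₊ := ⟨_, rfl⟩
  have hWle : (W:ℝ) ≤ K ^ (9 * k) * m := by rw [hW]; exact Nat.floor_le (by positivity)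
  have hmW : m ≤ W := by
    rw [hW]
    apply Nat.le_floor
    exact le_mul_of_one_le_left (by positivity) (one_le_pow₀ hK1)
  have hcard : #((k • (X.image φ) - k • (X.image φ)).erase 0) + 1 ≤ W := by
    have h0 : (0:ℤ) ∈ k • (X.image φ) - k • (X.image φ) := by
      obtain ⟨y, hy⟩ := (hXne.image φ).nsmul (n := k)
      have := sub_mem_sub hy hy
      rwa [sub_self] at this
    rw [card_erase_add_one h0, hW]
    apply Nat.le_floor
    refine le_trans ?_ (hpl k (by omega))
    exact_mod_cast hφ.card_le hXne (by omega)
  have hJ1 : 1 ≤ J := by omega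
  obtain ⟨N, hN1, hN2, hN3⟩ := nt_main J (2 ^ 140 * W * J ^ 17) hJ1
    ((k • (X.image φ) - k • (X.image φ)).erase 0) (by simp) (by
      intro d hd
      rw [mem_erase] at hd
      obtain ⟨u, hu, v, hv, rfl⟩ := Finset.mem_sub.1 hd.2
      obtain ⟨su, hsu, hsuc, rfl⟩ := fr_mem_nsmul_image X φ k u hu
      obtain ⟨sv, hsv, hsvc, rfl⟩ := fr_mem_nsmul_image X φ k v hv
      obtain ⟨Q, hQ⟩ : ∃ Q : ℕ, Q = 2 * (2 ^ ((3 * i₀ + 2) * s) * #(X - X)) := ⟨_, rfl⟩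
      rw [← hQ] at hφb
      have hk0 : (0:ℝ) < k := by exact_mod_cast (by omega : 0 < k)
      have hb : ∀ x ∈ X, ((|φ x| : ℤ) : ℝ) ≤ Q / (2 * k) := by
        intro x hx
        rw [le_div_iff₀ (by positivity)]
        have h1 := hφb x hx
        have h2 : (2:ℝ) * (3 * k) * ((|φ x| : ℤ) : ℝ) ≤ Q := by exact_mod_cast h1
        have h3 : (0:ℝ) ≤ ((|φ x| : ℤ) : ℝ) := by exact_mod_cast abs_nonneg _
        nlinarith [mul_nonneg hk0.le h3]
      have hb2 : ∀ x ∈ X, |(φ x : ℝ)| ≤ Q / (2 * k) := by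
        intro x hx
        have := hb x hx
        push_cast at this
        exact this
      have e1 := fr_abs_sum_le φ (Q / (2 * k)) su (fun x hx => hb2 x (hsu x hx))
      have e2 := fr_abs_sum_le φ (Q / (2 * k)) sv (fun x hx => hb2 x (hsv x hx))
      rw [hsuc] at e1
      rw [hsvc] at e2
      have e3 : (k:ℝ) * (Q / (2 * k)) = Q / 2 := by field_simp
      rw [e3] at e1 e2
      have e4 : |(((su.map φ).sum : ℤ) : ℝ) - (((sv.map φ).sum : ℤ) : ℝ)| ≤ Q := by
        refine (abs_sub _ _).trans ?_
        linarith
      have e5 : |(su.map φ).sum - (sv.map φ).sum| ≤ (Q:ℤ) := by exact_mod_cast e4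
      refine e5.trans ?_
      have e6 : Q ≤ 2 ^ J * (2 ^ 140 * W * J ^ 17) := by
        calc Q ≤ 2 * (2 ^ ((3 * i₀ + 2) * s) * (2 ^ s * m)) := by rw [hQ]; gcongr
          _ = 2 ^ J * m := by rw [hJ]; ring
          _ ≤ 2 ^ J * (2 ^ 140 * W * J ^ 17) := by
            apply Nat.mul_le_mul_left
            calc m ≤ W := hmW
              _ ≤ W * (2 ^ 140 * J ^ 17) := Nat.le_mul_of_pos_right _ (by positivity)
              _ = _ := by ring
      exact_mod_cast e6) (by gcongr)
  refine ⟨N, hN1, ?_, _, fr_to_zmod X φ k N (hφ.mono hXne (by omega)) hN3⟩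
  have h1 : (N:ℝ) ≤ ((2 ^ 140 * W * J ^ 17 : ℕ) : ℝ) := by exact_mod_cast hN2
  exact h1.trans (fr_num K m k s i₀ J W hK hk (by positivity) hs1 hs2 hi hJ hWle)


/-- **Ruzsa's model lemma for two sets (Proposition 6.2).** There is an absolute constant
`C > 0` such that: if `A, B ⊆ ℤ` are finite and nonempty with `|A + B| ≤ K min{|A|,|B|}`
(`K ≥ 2`) and `k ≥ 2`, then there are a positive integer `N ≤ K^{Ck} min{|A|,|B|}`, subsets
`A₁ ⊆ A` and `B₁ ⊆ B` with `|A₁| ≥ |A|/k`, `|B₁| ≥ |B|/k`, and a Freiman `k`-isomorphism `ψ`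
on `A₁ ∪ B₁` into `ℤ/Nℤ`, whose images `A'' = ψ(A₁)`, `B'' = ψ(B₁)` satisfy
`|A'' + B''| ≤ kK min{|A''|,|B''|}`. -/
theorem ruzsa_model_two_sets :
    ∃ C : ℝ, 0 < C ∧
      ∀ (A B : Finset ℤ) (K : ℝ) (k : ℕ), A.Nonempty → B.Nonempty → 2 ≤ K → 2 ≤ k →
        ((A + B).card : ℝ) ≤ K * min (A.card : ℝ) (B.card : ℝ) →
        ∃ N : ℕ, 0 < N ∧ (N : ℝ) ≤ K ^ (C * k) * min (A.card : ℝ) (B.card : ℝ) ∧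
          ∃ A₁ B₁ : Finset ℤ, A₁ ⊆ A ∧ B₁ ⊆ B ∧
            (A.card : ℝ) / k ≤ A₁.card ∧ (B.card : ℝ) / k ≤ B₁.card ∧
            ∃ ψ : ℤ → ZMod N,
              IsAddFreimanIso k ((A₁ ∪ B₁ : Finset ℤ) : Set ℤ) (ψ '' (A₁ ∪ B₁)) ψ ∧
              ((A₁.image ψ + B₁.image ψ).card : ℝ) ≤
                k * K * min ((A₁.image ψ).card : ℝ) ((B₁.image ψ).card : ℝ) := by
  
  refine ⟨623, by norm_num, ?_⟩
  intro A B K k hA hB hK hk h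
  obtain ⟨N, hN, hNle, ψ, hψ⟩ := fr_final A B K k hA hB hK hk h
  have hne : (A ∪ B).Nonempty := hA.mono Finset.subset_union_left
  have hk1 : (1:ℝ) ≤ k := by exact_mod_cast (by omega : 1 ≤ k)
  refine ⟨N, hN, ?_, A, B, Finset.Subset.refl _, Finset.Subset.refl _, ?_, ?_, ψ, ?_, ?_⟩
  · have e : K ^ ((623:ℝ) * k) = K ^ (623 * k) := by
      rw [← Real.rpow_natCast]; push_cast; rfl
    rw [e]; exact hNle
  · exact div_le_self (by positivity) hk1
  · exact div_le_self (by positivity) hk1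
  · have := hψ.iso hne (by omega)
    simpa using this
  · have hinj := hψ.injOn hne (by omega)
    rw [Finset.card_image_of_injOn (hinj.mono (by simp)),
      Finset.card_image_of_injOn (hinj.mono (by simp))]
    have h1 : ((A.image ψ + B.image ψ).card : ℝ) ≤ ((A + B).card : ℝ) := by
      exact_mod_cast hψ.card_add hA hk
    refine h1.trans (h.trans ?_)
    have hm : (0:ℝ) ≤ min (A.card : ℝ) (B.card : ℝ) := by positivity
    have : K ≤ k * K := le_mul_of_one_le_left (by linarith) hk1
    gcongr
end
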